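/- arXiv:2403.02658 — 2 statements merged into one kernel-verified Lean document; each statement's English description precedes it below -/
import Mathlib

section
/- Suppose (B1)–(B3): $T$ is a CEMPT on an infinite $\sigma$-finite space, $0<\mu(Y)<\infty$, $w_n^Y\sim n^{1-\alpha}\ell(n)$ with $\alpha\in(0,1)$, $\ell$ slowly varying, and $\{(w_n^Y)^{-1}\sum_{k=0}^{n-1}\hat T^k1_{Y_k}\}_{n\ge1}$ is bounded in $L^\infty(\mu)$. Set $a(t)=t/(\Gamma(1+\alpha)Q^Y(1/t))$. Then for every positive sequence $\tilde c(n)$ with $\tilde c(n)\to0$ and $\tilde c(n)a(n)\to\infty$: $\mu_{1_Y}(S_n^Y/a(n)\le\tilde c(n))\sim\frac{\sin(\pi\alpha)}{\pi\alpha}\tilde c(n)$ as $n\to\infty$. -/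
open MeasureTheory Filter Real Set
open scoped Topology ENNReal

/-- First return time to `Y` (value `⊤` if the orbit never returns). -/
noncomputable def firstReturn {X : Type*} (T : X → X) (Y : Set X) (x : X) : ℕ∞ :=
  ⨅ (k : ℕ) (_ : 1 ≤ k ∧ T^[k] x ∈ Y), (k : ℕ∞)

/-- The sets `Y₀ = Y`, `Yₙ = Yᶜ ∩ {φ = n}`. -/
noncomputable def Ypart {X : Type*} (T : X → X) (Y : Set X) : ℕ → Set X
  | 0 => Y
  | (n+1) => Yᶜ ∩ {x | firstReturn T Y x = ((n+1 : ℕ) : ℕ∞)}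

/-- The wandering rate `w_n^Y`. -/
noncomputable def wrate {X : Type*} [MeasurableSpace X] (T : X → X) (Y : Set X)
    (μ : Measure X) (n : ℕ) : ℝ≥0∞ :=
  ∑ k ∈ Finset.range n, μ (Y ∩ {x | (k : ℕ∞) < firstReturn T Y x})

/-- Laplace transform `Q^Y(s)` of the increments of the wandering rate. -/
noncomputable def QY {X : Type*} [MeasurableSpace X] (T : X → X) (Y : Set X)
    (μ : Measure X) (s : ℝ) : ℝ≥0∞ :=
  ∑' n : ℕ, ENNReal.ofReal (Real.exp (-(n : ℝ) * s)) *
    μ (Y ∩ {x | (n : ℕ∞) < firstReturn T Y x})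

/-- Occupation time of `A` by the orbit between times `1` and `n`. -/
noncomputable def occTime {X : Type*} (T : X → X) (A : Set X) (n : ℕ) (x : X) : ℕ :=
  ∑ k ∈ Finset.Icc 1 n, A.indicator (fun _ => (1:ℕ)) (T^[k] x)

/-- The Darling–Kac normalization `a(t) = t/(Γ(1+α) Q^Y(1/t))`. -/
noncomputable def aDK {X : Type*} [MeasurableSpace X] (T : X → X) (Y : Set X)
    (μ : Measure X) (α : ℝ) (t : ℝ) : ℝ :=
  t / (Real.Gamma (1 + α) * (QY T Y μ t⁻¹).toReal)

namespace DK

section dyn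
variable {X : Type*} {T : X → X} {Y : Set X}

/-- No visit to `Y` during times `1..k`. -/
def NV (T : X → X) (Y : Set X) (k : ℕ) : Set X := {x | ∀ j, 1 ≤ j → j ≤ k → T^[j] x ∉ Y}

/-- First visit to `Y` exactly at time `k+1`. -/
def EV (T : X → X) (Y : Set X) (k : ℕ) : Set X := NV T Y k ∩ {x | T^[k+1] x ∈ Y}

lemma lt_firstReturn_iff (x : X) (k : ℕ) : (k : ℕ∞) < firstReturn T Y x ↔ x ∈ NV T Y k := by
  rw [← not_le]
  constructor
  · intro h j h1 h2 h3
    apply h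
    unfold firstReturn
    exact (iInf₂_le j ⟨h1, h3⟩).trans (by exact_mod_cast h2)
  · intro h h2
    have : ((k + 1 : ℕ) : ℕ∞) ≤ firstReturn T Y x := by
      unfold firstReturn
      refine le_iInf₂ fun j hj => ?_
      by_contra hc
      push Not at hc
      have : j < k + 1 := by exact_mod_cast hc
      exact h j hj.1 (by omega) hj.2
    have := this.trans h2
    have : k + 1 ≤ k := by exact_mod_cast this
    omega

lemma NV_set (k : ℕ) : {x | (k : ℕ∞) < firstReturn T Y x} = NV T Y k := by
  ext x; exact lt_firstReturn_iff x k

lemma NV_succ (k : ℕ) (x : X) : x ∈ NV T Y (k+1) ↔ x ∈ NV T Y k ∧ T^[k+1] x ∉ Y := by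
  constructor
  · intro h
    exact ⟨fun j h1 h2 => h j h1 (by omega), h (k+1) (by omega) le_rfl⟩
  · rintro ⟨h, h'⟩ j h1 h2
    rcases Nat.lt_or_ge j (k+1) with h3 | h3
    · exact h j h1 (by omega)
    · have : j = k+1 := by omega
      subst this; exact h'

lemma NV_succ' (k : ℕ) (x : X) : x ∈ NV T Y (k+1) ↔ T x ∉ Y ∧ T x ∈ NV T Y k := by
  constructor
  · intro h
    refine ⟨by simpa using h 1 le_rfl (by omega), fun j h1 h2 => ?_⟩
    simpa using h (j+1) (by omega) (by omega)
  · rintro ⟨h, h'⟩ j h1 h2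
    obtain ⟨j, rfl⟩ : ∃ i, j = i + 1 := ⟨j-1, by omega⟩
    rcases Nat.eq_zero_or_pos j with rfl | h3
    · simpa using h
    · simpa using h' j h3 (by omega)

lemma EV_iff (x : X) (k : ℕ) :
    firstReturn T Y x = ((k+1 : ℕ) : ℕ∞) ↔ x ∈ EV T Y k := by
  constructor
  · intro h
    have h1 : x ∈ NV T Y k := by
      rw [← lt_firstReturn_iff, h]; exact_mod_cast Nat.lt_succ_self k
    refine ⟨h1, ?_⟩
    by_contra hc
    have h2 : x ∈ NV T Y (k+1) := (NV_succ k x).2 ⟨h1, hc⟩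
    rw [← lt_firstReturn_iff, h] at h2
    exact lt_irrefl _ h2
  · rintro ⟨h1, h2⟩
    apply le_antisymm
    · unfold firstReturn
      exact iInf₂_le (k+1) ⟨by omega, h2⟩
    · rw [← lt_firstReturn_iff] at h1
      have := Order.add_one_le_of_lt h1
      exact_mod_cast this

lemma Ypart_succ (k : ℕ) : Ypart T Y (k+1) = Yᶜ ∩ EV T Y k := by
  ext x
  simp only [Ypart, mem_inter_iff, mem_ofPred_eq, EV_iff]

lemma preimage_Ypart (k : ℕ) : T ⁻¹' (Ypart T Y k) = EV T Y k := by
  ext x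
  cases k with
  | zero =>
    simp only [Ypart, EV, NV, mem_preimage, mem_inter_iff, mem_ofPred_eq]
    constructor
    · intro h; exact ⟨fun j h1 h2 => by omega, by simpa using h⟩
    · rintro ⟨_, h⟩; simpa using h
  | succ k =>
    rw [Ypart_succ]
    simp only [EV, mem_preimage, mem_inter_iff, mem_compl_iff, NV_succ', mem_ofPred_eq,
      Function.iterate_succ_apply]
    tauto

lemma occ_zero (x : X) : occTime T Y 0 x = 0 := by simp [occTime]

lemma sum_Icc_range (f : ℕ → ℕ) (n : ℕ) :
    ∑ k ∈ Finset.Icc 1 n, f k = ∑ k ∈ Finset.range n, f (k+1) := by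
  induction n with
  | zero => simp
  | succ n ih => rw [Finset.sum_Icc_succ_top (by omega), ih, Finset.sum_range_succ]

lemma occ_succ (n : ℕ) (x : X) :
    occTime T Y (n+1) x = Y.indicator (fun _ => (1:ℕ)) (T x) + occTime T Y n (T x) := by
  unfold occTime
  rw [sum_Icc_range, sum_Icc_range, Finset.sum_range_succ', add_comm]
  simp only [Function.iterate_succ_apply, Function.iterate_zero, id]

lemma occ_mono {m n : ℕ} (h : m ≤ n) (x : X) : occTime T Y m x ≤ occTime T Y n x := by
  unfold occTime
  apply Finset.sum_le_sum_of_subset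
  exact Finset.Icc_subset_Icc le_rfl h

lemma occ_NV (n : ℕ) (x : X) (h : x ∈ NV T Y n) : occTime T Y n x = 0 := by
  unfold occTime
  apply Finset.sum_eq_zero
  intro k hk
  rw [Finset.mem_Icc] at hk
  rw [indicator_of_notMem]
  exact h k hk.1 hk.2

lemma occ_EV (k m : ℕ) (x : X) (h : x ∈ EV T Y k) :
    occTime T Y (m + k + 1) x = 1 + occTime T Y m (T^[k+1] x) := by
  induction k generalizing x with
  | zero =>
    rw [occ_succ]
    have : T x ∈ Y := by simpa using h.2
    simp [this]
  | succ k ih =>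
    have h1 := (NV_succ' k x).1 h.1
    have h2 : T x ∈ EV T Y k := ⟨h1.2, by simpa using h.2⟩
    rw [occ_succ, indicator_of_notMem h1.1, zero_add, ← add_assoc, ih _ h2,
      Function.iterate_succ_apply]
    simp

variable [MeasurableSpace X] {μ : Measure X}

lemma meas_NV (hT : Measurable T) (hY : MeasurableSet Y) (k : ℕ) : MeasurableSet (NV T Y k) := by
  have : NV T Y k = ⋂ (j : ℕ) (_ : 1 ≤ j) (_ : j ≤ k), (T^[j] ⁻¹' Y)ᶜ := by
    ext x; simp [NV]
  rw [this]
  refine MeasurableSet.iInter fun j => MeasurableSet.iInter fun _ => MeasurableSet.iInter fun _ => ?_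
  exact ((hT.iterate j) hY).compl

lemma meas_EV (hT : Measurable T) (hY : MeasurableSet Y) (k : ℕ) : MeasurableSet (EV T Y k) :=
  (meas_NV hT hY k).inter ((hT.iterate (k+1)) hY)

lemma meas_Ypart (hT : Measurable T) (hY : MeasurableSet Y) (k : ℕ) :
    MeasurableSet (Ypart T Y k) := by
  cases k with
  | zero => exact hY
  | succ k => rw [Ypart_succ]; exact hY.compl.inter (meas_EV hT hY k)

lemma meas_occ (hT : Measurable T) (hY : MeasurableSet Y) (n : ℕ) :
    Measurable (occTime T Y n) := by
  unfold occTime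
  refine Finset.measurable_sum _ fun k _ => ?_
  exact (measurable_const.indicator hY).comp (hT.iterate k)

lemma meas_pow (hT : Measurable T) (hY : MeasurableSet Y) (n : ℕ) (z : ℝ≥0∞) :
    Measurable (fun x => z ^ occTime T Y n x) :=
  (measurable_from_top (f := fun n : ℕ => z ^ n)).comp (meas_occ hT hY n)

/-- `q_k`. -/
noncomputable def qk (T : X → X) (Y : Set X) (μ : Measure X) (k : ℕ) : ℝ≥0∞ := μ (Y ∩ NV T Y k)

lemma wrate_eq (n : ℕ) : wrate T Y μ n = ∑ k ∈ Finset.range n, qk T Y μ k := by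
  simp only [wrate, NV_set, qk]

lemma lint_NV_split (hT : Measurable T) (hY : MeasurableSet Y) (f : X → ℝ≥0∞) (k : ℕ) :
    ∫⁻ x in Y ∩ NV T Y k, f x ∂μ
      = ∫⁻ x in Y ∩ NV T Y (k+1), f x ∂μ + ∫⁻ x in Y ∩ EV T Y k, f x ∂μ := by
  rw [← lintegral_union (hY.inter (meas_EV hT hY k))]
  · congr 2
    ext x
    simp only [mem_inter_iff, mem_union, NV_succ, EV, mem_ofPred_eq]
    tauto
  · rw [Set.disjoint_left]
    rintro x ⟨_, h⟩ ⟨_, h'⟩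
    exact ((NV_succ k x).1 h).2 h'.2

lemma lint_Y_split (hT : Measurable T) (hY : MeasurableSet Y) (f : X → ℝ≥0∞) (n : ℕ) :
    ∫⁻ x in Y, f x ∂μ = ∫⁻ x in Y ∩ NV T Y n, f x ∂μ
      + ∑ k ∈ Finset.range n, ∫⁻ x in Y ∩ EV T Y k, f x ∂μ := by
  induction n with
  | zero =>
    have : NV T Y 0 = univ := by
      ext x; simp only [NV, mem_ofPred_eq, mem_univ, iff_true]; intro j h1 h2; omega
    simp [this]
  | succ n ih =>
    rw [ih, lint_NV_split hT hY, Finset.sum_range_succ]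
    ring

lemma lint_EV (hT : Measurable T) (hY : MeasurableSet Y) (f : X → ℝ≥0∞) (k : ℕ) :
    ∫⁻ x in EV T Y k, f x ∂μ
      = ∫⁻ x in Ypart T Y (k+1), f x ∂μ + ∫⁻ x in Y ∩ EV T Y k, f x ∂μ := by
  rw [Ypart_succ, ← lintegral_union (hY.inter (meas_EV hT hY k))]
  · congr 2
    ext x
    simp only [mem_inter_iff, mem_union, mem_compl_iff]
    tauto
  · rw [Set.disjoint_left]
    rintro x ⟨h, _⟩ ⟨h', _⟩
    exact h h'

lemma measure_Ypart (hT : MeasurePreserving T μ μ) (hY : MeasurableSet Y) (hY1 : μ Y < ⊤) (k : ℕ) :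
    μ (Ypart T Y k) = qk T Y μ k := by
  induction k with
  | zero =>
    have : NV T Y 0 = univ := by
      ext x; simp only [NV, mem_ofPred_eq, mem_univ, iff_true]; intro j h1 h2; omega
    simp [qk, this, Ypart]
  | succ k ih =>
    have h1 := lint_EV (μ := μ) hT.measurable hY (fun _ => 1) k
    have h2 := lint_NV_split (μ := μ) hT.measurable hY (fun _ => 1) k
    simp only [lintegral_const, one_mul, Measure.restrict_apply MeasurableSet.univ, univ_inter] at h1 h2
    rw [← preimage_Ypart, hT.measure_preimage (meas_Ypart hT.measurable hY k).nullMeasurableSet, ih,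
      preimage_Ypart, qk, h2] at h1
    have h3 : μ (Y ∩ EV T Y k) ≠ ⊤ := (lt_of_le_of_lt (measure_mono inter_subset_left) hY1).ne
    exact ((ENNReal.add_left_inj h3).1 h1).symm

/-- `r k m = ∫_{Y_k} z^{S_m ∘ T^k}`. -/
noncomputable def rr (T : X → X) (Y : Set X) (μ : Measure X) (z : ℝ≥0∞) (k m : ℕ) : ℝ≥0∞ :=
  ∫⁻ x in Ypart T Y k, z ^ occTime T Y m (T^[k] x) ∂μ

lemma rr_step (hT : MeasurePreserving T μ μ) (hY : MeasurableSet Y) (z : ℝ≥0∞) (k m : ℕ) :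
    z * rr T Y μ z k m = z * rr T Y μ z (k+1) m
      + ∫⁻ x in Y ∩ EV T Y k, z ^ occTime T Y (m+k+1) x ∂μ := by
  have hm : ∀ k m, Measurable (fun x => z ^ occTime T Y m (T^[k] x)) := fun k m =>
    (meas_pow hT.measurable hY m z).comp (hT.measurable.iterate k)
  have h1 : rr T Y μ z k m = ∫⁻ x in EV T Y k, z ^ occTime T Y m (T^[k+1] x) ∂μ := by
    rw [← preimage_Ypart, rr]
    rw [← hT.setLIntegral_comp_preimage (meas_Ypart hT.measurable hY k) (hm k m)]
    simp only [Function.iterate_succ_apply]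
  rw [h1, lint_EV hT.measurable hY, mul_add]
  congr 1
  rw [← lintegral_const_mul _ (hm (k+1) m)]
  apply setLIntegral_congr_fun (hY.inter (meas_EV hT.measurable hY k))
  intro x hx
  simp only
  rw [occ_EV k m x hx.2, pow_add, pow_one]

lemma main_identity (hT : MeasurePreserving T μ μ) (hY : MeasurableSet Y) (z p : ℝ≥0∞)
    (hpz : p + z = 1) (n : ℕ) :
    p * ∑ j ∈ Finset.range n, rr T Y μ z 0 j
      + z * ∑ k ∈ Finset.range n, rr T Y μ z k (n-1-k) = wrate T Y μ n := by
  induction n with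
  | zero => simp [wrate]
  | succ n ih =>
    have hw : wrate T Y μ (n+1) = wrate T Y μ n + qk T Y μ n := by
      rw [wrate_eq, wrate_eq, Finset.sum_range_succ]
    rw [hw, ← ih, Finset.sum_range_succ (fun j => rr T Y μ z 0 j)]
    rw [Finset.sum_range_succ' (fun k => rr T Y μ z k (n+1-1-k))]
    have h0 : rr T Y μ z 0 n = qk T Y μ n
      + ∑ k ∈ Finset.range n, ∫⁻ x in Y ∩ EV T Y k, z ^ occTime T Y n x ∂μ := by
      have : rr T Y μ z 0 n = ∫⁻ x in Y, z ^ occTime T Y n x ∂μ := by simp [rr, Ypart]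
      rw [this, lint_Y_split hT.measurable hY _ n]
      congr 1
      rw [qk, ← setLIntegral_one]
      apply setLIntegral_congr_fun (hY.inter (meas_NV hT.measurable hY n))
      intro x hx
      simp [occ_NV n x hx.2]
    have h1 : z * ∑ k ∈ Finset.range n, rr T Y μ z k (n-1-k)
        = z * ∑ k ∈ Finset.range n, rr T Y μ z (k+1) (n+1-1-(k+1))
          + ∑ k ∈ Finset.range n, ∫⁻ x in Y ∩ EV T Y k, z ^ occTime T Y n x ∂μ := by
      rw [Finset.mul_sum, Finset.mul_sum, ← Finset.sum_add_distrib]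
      apply Finset.sum_congr rfl
      intro k hk
      rw [Finset.mem_range] at hk
      rw [rr_step hT hY, show n - 1 - k + k + 1 = n by omega, show n+1-1-(k+1) = n-1-k by omega]
    rw [h1]
    have h2 : p * rr T Y μ z 0 n + z * rr T Y μ z 0 n = rr T Y μ z 0 n := by
      rw [← add_mul, hpz, one_mul]
    rw [show n + 1 - 1 - 0 = n by omega]
    calc _ = p * ∑ j ∈ Finset.range n, rr T Y μ z 0 j
        + z * ∑ k ∈ Finset.range n, rr T Y μ z (k+1) (n+1-1-(k+1))
        + (p * rr T Y μ z 0 n + z * rr T Y μ z 0 n) := by ring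
      _ = _ := by rw [h2, h0]; ring

lemma iter_dual (hT : Measurable T) {hatT : (X → ℝ≥0∞) → (X → ℝ≥0∞)}
    (hatTmeas : ∀ u, Measurable u → Measurable (hatT u))
    (hatTdual : ∀ u v : X → ℝ≥0∞, Measurable u → Measurable v →
      ∫⁻ x, v (T x) * u x ∂μ = ∫⁻ x, v x * hatT u x ∂μ) (k : ℕ) :
    ∀ u v : X → ℝ≥0∞, Measurable u → Measurable v →
      Measurable (hatT^[k] u) ∧ ∫⁻ x, v (T^[k] x) * u x ∂μ = ∫⁻ x, v x * (hatT^[k] u) x ∂μ := by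
  induction k with
  | zero => intro u v hu hv; simpa using hu
  | succ k ih =>
    intro u v hu hv
    have := ih (hatT u) v (hatTmeas u hu) hv
    refine ⟨by simpa using this.1, ?_⟩
    simp only [Function.iterate_succ_apply]
    rw [← this.2, ← hatTdual u (fun x => v (T^[k] x)) hu (hv.comp (hT.iterate k))]

lemma rr_bound (hT : MeasurePreserving T μ μ) (hY : MeasurableSet Y) (hY1 : μ Y < ⊤)
    {hatT : (X → ℝ≥0∞) → (X → ℝ≥0∞)}
    (hatTmeas : ∀ u, Measurable u → Measurable (hatT u))
    (hatTdual : ∀ u v : X → ℝ≥0∞, Measurable u → Measurable v →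
      ∫⁻ x, v (T x) * u x ∂μ = ∫⁻ x, v x * hatT u x ∂μ)
    {C : ℝ≥0∞} (hB3 : ∀ n : ℕ, 1 ≤ n → ∀ᵐ x ∂μ,
      ∑ k ∈ Finset.range n, (hatT^[k] ((Ypart T Y k).indicator fun _ => (1:ℝ≥0∞))) x
        ≤ C * wrate T Y μ n) (z : ℝ≥0∞) (hz : z ≤ 1) (m n : ℕ) (hmn : m ≤ n) :
    ∑ k ∈ Finset.range n, rr T Y μ z k (n-1-k)
      ≤ C * wrate T Y μ m * rr T Y μ z 0 (n - m) + ∑ k ∈ Finset.Ico m n, qk T Y μ k := by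
  rw [← Finset.sum_range_add_sum_Ico _ hmn]
  gcongr with k hk
  · rcases Nat.eq_zero_or_pos m with rfl | hm
    · simp
    set v : X → ℝ≥0∞ := Y.indicator (fun x => z ^ occTime T Y (n-m) x) with hv
    have hvm : Measurable v := (meas_pow hT.measurable hY _ z).indicator hY
    have hum : ∀ k, Measurable ((Ypart T Y k).indicator fun _ => (1:ℝ≥0∞)) := fun k =>
      measurable_const.indicator (meas_Ypart hT.measurable hY k)
    have hd := fun k => iter_dual hT.measurable hatTmeas hatTdual k _ v (hum k) hvm
    calc ∑ k ∈ Finset.range m, rr T Y μ z k (n-1-k)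
        ≤ ∑ k ∈ Finset.range m,
          ∫⁻ x, v (T^[k] x) * (Ypart T Y k).indicator (fun _ => (1:ℝ≥0∞)) x ∂μ := by
          refine Finset.sum_le_sum fun k hk => ?_
          rw [Finset.mem_range] at hk
          rw [rr, ← lintegral_indicator (meas_Ypart hT.measurable hY k)]
          apply lintegral_mono
          intro x
          by_cases hx : x ∈ Ypart T Y k
          · have hxY : T^[k] x ∈ Y := by
              cases k with
              | zero => exact hx
              | succ k => rw [Ypart_succ] at hx; exact hx.2.2
            simp only [indicator_of_mem hx, hv, indicator_of_mem hxY, mul_one]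
            exact pow_le_pow_right_of_le_one' hz (occ_mono (by omega) _)
          · simp [indicator_of_notMem hx]
      _ = ∑ k ∈ Finset.range m,
          ∫⁻ x, v x * (hatT^[k] ((Ypart T Y k).indicator fun _ => (1:ℝ≥0∞))) x ∂μ :=
          Finset.sum_congr rfl fun k _ => (hd k).2
      _ = ∫⁻ x, v x * ∑ k ∈ Finset.range m,
          (hatT^[k] ((Ypart T Y k).indicator fun _ => (1:ℝ≥0∞))) x ∂μ := by
          simp only [Finset.mul_sum]
          exact (lintegral_finsetSum _ fun k _ => hvm.mul (hd k).1).symm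
      _ ≤ ∫⁻ x, v x * (C * wrate T Y μ m) ∂μ := by
          apply lintegral_mono_ae
          filter_upwards [hB3 m hm] with x hx
          gcongr
      _ = _ := by
          rw [lintegral_mul_const _ hvm, mul_comm, hv, lintegral_indicator hY]
          simp [rr, Ypart]
  · rw [← measure_Ypart hT hY hY1, rr, ← setLIntegral_one]
    apply lintegral_mono
    intro x
    exact pow_le_one' hz _

end dyn

section ana

/-- partial sums -/
noncomputable def ww (q : ℕ → ℝ) (n : ℕ) : ℝ := ∑ k ∈ Finset.range n, q k

variable {q : ℕ → ℝ}

lemma ww_mono (h0 : ∀ k, 0 ≤ q k) : Monotone (ww q) := by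
  apply monotone_nat_of_le_succ
  intro n
  rw [ww, ww, Finset.sum_range_succ]
  linarith [h0 n]

lemma ww_pos (h0 : ∀ k, 0 ≤ q k) (hq : 0 < q 0) {n : ℕ} (hn : 1 ≤ n) : 0 < ww q n := by
  have : ww q 1 ≤ ww q n := ww_mono h0 hn
  simp [ww] at this
  simp only [ww]
  linarith

lemma ww_conc (hanti : Antitone q) {m n : ℕ} (hmn : m ≤ n) :
    (m : ℝ) * ww q n ≤ n * ww q m := by
  have h1 : (m : ℝ) * q m ≤ ww q m := by
    have := Finset.card_nsmul_le_sum (Finset.range m) q (q m)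
      (fun k hk => hanti (Finset.mem_range.1 hk).le)
    simpa [ww] using this
  have h2 : ww q n ≤ ww q m + (n - m) * q m := by
    have := Finset.sum_le_card_nsmul (Finset.Ico m n) q (q m)
      (fun k hk => hanti (Finset.mem_Ico.1 hk).1)
    rw [ww, ← Finset.sum_range_add_sum_Ico _ hmn]
    simp [Nat.cast_sub hmn] at this
    simp only [ww]; linarith
  have h3 : (m:ℝ) ≤ n := by exact_mod_cast hmn
  have h4 : (0:ℝ) ≤ m := by positivity
  nlinarith [mul_le_mul_of_nonneg_left h2 h4, mul_le_mul_of_nonneg_left h1 (sub_nonneg.2 h3)]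

lemma ww_ratio_bounds (h0 : ∀ k, 0 ≤ q k) (hq : 0 < q 0) (hanti : Antitone q) {a b : ℕ}
    (ha : 1 ≤ a) (hb : 1 ≤ b) :
    min 1 ((a:ℝ)/b) ≤ ww q a / ww q b ∧ ww q a / ww q b ≤ max 1 ((a:ℝ)/b) := by
  have wa := ww_pos h0 hq ha
  have wb := ww_pos h0 hq hb
  have ha' : (0:ℝ) < a := by exact_mod_cast ha
  have hb' : (0:ℝ) < b := by exact_mod_cast hb
  rcases le_total a b with h | h
  · constructor
    · apply (min_le_right _ _).trans
      rw [div_le_div_iff₀ hb' wb]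
      linarith [ww_conc hanti h]
    · apply le_max_of_le_left
      rw [div_le_one wb]
      exact ww_mono h0 h
  · constructor
    · apply (min_le_left _ _).trans
      rw [le_div_iff₀ wb, one_mul]
      exact ww_mono h0 h
    · apply le_max_of_le_right
      rw [div_le_div_iff₀ wb hb']
      linarith [ww_conc hanti h]

lemma ww_ratio_one (h0 : ∀ k, 0 ≤ q k) (hq : 0 < q 0) (hanti : Antitone q) {a b : ℕ → ℕ}
    (ha : ∀ᶠ n in atTop, 1 ≤ a n) (hb : ∀ᶠ n in atTop, 1 ≤ b n)
    (hab : Tendsto (fun n => (a n : ℝ) / b n) atTop (𝓝 1)) :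
    Tendsto (fun n => ww q (a n) / ww q (b n)) atTop (𝓝 1) := by
  have h1 : Tendsto (fun n => min 1 ((a n : ℝ) / b n)) atTop (𝓝 1) := by
    simpa using (tendsto_const_nhds (x := (1:ℝ))).min hab
  have h2 : Tendsto (fun n => max 1 ((a n : ℝ) / b n)) atTop (𝓝 1) := by
    simpa using (tendsto_const_nhds (x := (1:ℝ))).max hab
  refine tendsto_of_tendsto_of_tendsto_of_le_of_le' h1 h2 ?_ ?_
  · filter_upwards [ha, hb] with n h h'
    exact (ww_ratio_bounds h0 hq hanti h h').1
  · filter_upwards [ha, hb] with n h h'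
    exact (ww_ratio_bounds h0 hq hanti h h').2

lemma floor_div_tendsto {x : ℝ} (hx : 0 < x) :
    Tendsto (fun n : ℕ => (⌊x * n⌋₊ : ℝ) / n) atTop (𝓝 x) :=
  (tendsto_nat_floor_mul_div_atTop hx.le).comp tendsto_natCast_atTop_atTop

lemma floor_tendsto {x : ℝ} (hx : 0 < x) :
    Tendsto (fun n : ℕ => ⌊x * n⌋₊) atTop atTop :=
  tendsto_nat_floor_atTop.comp (tendsto_natCast_atTop_atTop.const_mul_atTop hx)

lemma ww_nat_rv {β : ℝ} {ℓ : ℝ → ℝ} (hℓpos : ∀ t, 0 < t → 0 < ℓ t)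
    (hℓsv : ∀ lam : ℝ, 0 < lam → Tendsto (fun t => ℓ (lam * t) / ℓ t) atTop (𝓝 1))
    (hw : Tendsto (fun n : ℕ => ww q n / ((n : ℝ) ^ β * ℓ n)) atTop (𝓝 1))
    {k : ℕ} (hk : 1 ≤ k) :
    Tendsto (fun n : ℕ => ww q (k * n) / ww q n) atTop (𝓝 ((k:ℝ) ^ β)) := by
  have hk0 : (0:ℝ) < k := by exact_mod_cast hk
  have hkn : Tendsto (fun n : ℕ => k * n) atTop atTop :=
    tendsto_id.const_mul_atTop' (by omega)
  have h1 := hw.comp hkn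
  have h2 := (hℓsv k hk0).comp (tendsto_natCast_atTop_atTop (R := ℝ))
  have h3 := ((h1.mul h2).div hw one_ne_zero).const_mul ((k:ℝ)^β)
  simp only [mul_one, div_one] at h3
  refine h3.congr' ?_
  filter_upwards [eventually_ge_atTop 1] with n hn
  have hn0 : (0:ℝ) < n := by exact_mod_cast hn
  have e1 := hℓpos n hn0
  have e2 := hℓpos (k * n) (by positivity)
  have e3 : (0:ℝ) < (n:ℝ)^β := by positivity
  have e4 : (0:ℝ) < (k:ℝ)^β := by positivity
  simp only [Function.comp, Pi.div_apply, Nat.cast_mul]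
  rw [Real.mul_rpow hk0.le hn0.le]
  by_cases hz : ww q n = 0
  · simp [hz]
  field_simp

lemma ww_rat_rv (h0 : ∀ k, 0 ≤ q k) (hq : 0 < q 0) (hanti : Antitone q) {β : ℝ}
    (hk : ∀ k : ℕ, 1 ≤ k → Tendsto (fun n : ℕ => ww q (k * n) / ww q n) atTop (𝓝 ((k:ℝ) ^ β)))
    {j k : ℕ} (hj1 : 1 ≤ j) (hk1 : 1 ≤ k) :
    Tendsto (fun n : ℕ => ww q ⌊((j:ℝ)/k) * n⌋₊ / ww q n) atTop (𝓝 (((j:ℝ)/k) ^ β)) := by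
  have hk0 : (0:ℝ) < k := by exact_mod_cast hk1
  have hj0 : (0:ℝ) < j := by exact_mod_cast hj1
  set m : ℕ → ℕ := fun n => ⌊(1/(k:ℝ)) * n⌋₊ with hm
  have hmt : Tendsto m atTop atTop := floor_tendsto (by positivity)
  have hmr : Tendsto (fun n : ℕ => (m n : ℝ) / n) atTop (𝓝 (1/(k:ℝ))) :=
    floor_div_tendsto (by positivity)
  have hxt := floor_tendsto (x := (j:ℝ)/k) (by positivity)
  have hxr := floor_div_tendsto (x := (j:ℝ)/k) (by positivity)
  have hm1 := hmt.eventually_ge_atTop 1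
  have A : Tendsto (fun n : ℕ => ww q ⌊((j:ℝ)/k) * n⌋₊ / ww q (j * m n)) atTop (𝓝 1) := by
    apply ww_ratio_one h0 hq hanti (hxt.eventually_ge_atTop 1)
    · filter_upwards [hm1] with n hn
      exact Nat.mul_pos hj1 hn
    · have := hxr.div (hmr.const_mul (j:ℝ)) (by positivity)
      rw [show (j:ℝ)/k / (j * (1/(k:ℝ))) = 1 by field_simp] at this
      refine this.congr' ?_
      filter_upwards [eventually_ge_atTop 1, hm1] with n hn hn'
      have : (0:ℝ) < n := by exact_mod_cast hn
      have : (0:ℝ) < m n := by exact_mod_cast hn'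
      simp only [Pi.div_apply, Nat.cast_mul]
      field_simp
  have B : Tendsto (fun n => ww q (k * m n) / ww q n) atTop (𝓝 1) := by
    apply ww_ratio_one h0 hq hanti _ (eventually_ge_atTop 1)
    · have := hmr.const_mul (k:ℝ)
      rw [show (k * (1/(k:ℝ))) = 1 by field_simp] at this
      refine this.congr ?_
      intro n
      push_cast; ring
    · filter_upwards [hm1] with n hn
      exact Nat.mul_pos hk1 hn
  have D := ((hk j hj1).comp hmt).div ((hk k hk1).comp hmt) (by positivity)
  have E := (A.mul D).mul B
  rw [one_mul, mul_one, ← Real.div_rpow hj0.le hk0.le] at E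
  refine E.congr' ?_
  filter_upwards [eventually_ge_atTop 1, hm1] with n hn hn'
  have e1 := ww_pos h0 hq hn
  have e2 := ww_pos h0 hq hn'
  have e3 := ww_pos h0 hq (Nat.mul_pos hj1 hn')
  have e4 := ww_pos h0 hq (Nat.mul_pos hk1 hn')
  simp only [Function.comp, Pi.div_apply]
  field_simp

lemma ww_rv (h0 : ∀ k, 0 ≤ q k) (hq : 0 < q 0) (hanti : Antitone q) {β : ℝ}
    (hk : ∀ k : ℕ, 1 ≤ k → Tendsto (fun n : ℕ => ww q (k * n) / ww q n) atTop (𝓝 ((k:ℝ) ^ β)))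
    {x : ℝ} (hx : 0 < x) :
    Tendsto (fun n : ℕ => ww q ⌊x * n⌋₊ / ww q n) atTop (𝓝 (x ^ β)) := by
  have key : ∀ y : ℚ, 0 < (y:ℝ) →
      Tendsto (fun n : ℕ => ww q ⌊(y:ℝ) * n⌋₊ / ww q n) atTop (𝓝 ((y:ℝ) ^ β)) := by
    intro y hy
    have hy' : 0 < y := by exact_mod_cast hy
    have hnum : 0 < y.num := Rat.num_pos.2 hy'
    have := ww_rat_rv h0 hq hanti hk (j := y.num.toNat) (k := y.den) (by omega) y.den_pos
    have e : ((y.num.toNat : ℕ) : ℝ) / (y.den : ℝ) = (y : ℝ) := by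
      rw [Rat.cast_def]
      congr 1
      have : ((y.num.toNat : ℕ) : ℤ) = y.num := Int.toNat_of_nonneg hnum.le
      exact_mod_cast this
    rwa [e] at this
  have hc : ContinuousAt (fun y : ℝ => y ^ β) x := Real.continuousAt_rpow_const x β (Or.inl hx.ne')
  have mono : ∀ (y y' : ℝ) (n : ℕ), y ≤ y' →
      ww q ⌊y * n⌋₊ / ww q n ≤ ww q ⌊y' * n⌋₊ / ww q n := by
    intro y y' n h
    apply div_le_div_of_nonneg_right
    · apply ww_mono h0
      apply Nat.floor_mono
      gcongr
    · exact Finset.sum_nonneg fun k _ => h0 k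
  rw [tendsto_order]
  constructor
  · intro a ha
    have h1 : ∀ᶠ y in 𝓝 x, a < y ^ β ∧ 0 < y := (hc.eventually_const_lt ha).and (lt_mem_nhds hx)
    obtain ⟨c, hcx, hc'⟩ := exists_Ioc_subset_of_mem_nhds h1 ⟨x - 1, by linarith⟩
    obtain ⟨y, hy1, hy2⟩ := exists_rat_btwn hcx
    obtain ⟨hy3, hy4⟩ := hc' ⟨hy1, hy2.le⟩
    filter_upwards [(key y hy4).eventually_const_lt hy3] with n hn
    exact hn.trans_le (mono _ _ _ hy2.le)
  · intro a ha
    have h1 : ∀ᶠ y in 𝓝 x, y ^ β < a ∧ 0 < y := (hc.eventually_lt_const ha).and (lt_mem_nhds hx)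
    obtain ⟨c, hcx, hc'⟩ := exists_Ico_subset_of_mem_nhds h1 ⟨x + 1, by linarith⟩
    obtain ⟨y, hy1, hy2⟩ := exists_rat_btwn hcx
    obtain ⟨hy3, hy4⟩ := hc' ⟨hy1.le, hy2⟩
    filter_upwards [(key y hy4).eventually_lt_const hy3] with n hn
    exact (mono _ _ _ hy1.le).trans_lt hn

lemma int_exp (a : ℝ) : Integrable (fun x => Real.exp (-x)) (volume.restrict (Ioi a)) := by
  have : IntegrableOn (fun x => Real.exp (-x)) (Ioi a) volume := by
    simpa using (integrableOn_exp_mul_Ioi (a := -1) (by norm_num) a)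
  exact this

lemma lint_exp (a : ℝ) : ∫⁻ x in Ioi a, ENNReal.ofReal (Real.exp (-x)) = ENNReal.ofReal (Real.exp (-a)) := by
  rw [← integral_exp_neg_Ioi a, ofReal_integral_eq_lintegral_ofReal]
  · exact int_exp a
  · exact Eventually.of_forall fun x => (Real.exp_pos _).le

lemma Q_eq (h0 : ∀ k, 0 ≤ q k) {s : ℝ} (hs : 0 < s) :
    ∑' n : ℕ, ENNReal.ofReal (Real.exp (-(n:ℝ) * s)) * ENNReal.ofReal (q n)
      = ∫⁻ x in Ioi (0:ℝ), ENNReal.ofReal (Real.exp (-x) * ww q (⌊x / s⌋₊ + 1)) := by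
  have h1 : ∀ x ∈ Ioi (0:ℝ), ENNReal.ofReal (Real.exp (-x) * ww q (⌊x / s⌋₊ + 1))
      = ∑' n : ℕ, (Ici (n * s)).indicator (fun x => ENNReal.ofReal (Real.exp (-x))) x
        * ENNReal.ofReal (q n) := by
    intro x hx
    have hx : 0 < x := hx
    rw [ENNReal.ofReal_mul (Real.exp_pos _).le, ww, ENNReal.ofReal_sum_of_nonneg (fun k _ => h0 k),
      Finset.mul_sum, tsum_eq_sum (s := Finset.range (⌊x / s⌋₊ + 1))]
    · apply Finset.sum_congr rfl
      intro k hk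
      rw [Finset.mem_range, Nat.lt_succ_iff, Nat.le_floor_iff (by positivity), le_div_iff₀ hs] at hk
      rw [indicator_of_mem (show x ∈ Ici (k * s) from hk)]
    · intro k hk
      rw [Finset.mem_range, Nat.lt_succ_iff, Nat.le_floor_iff (by positivity), le_div_iff₀ hs] at hk
      rw [indicator_of_notMem (show x ∉ Ici (k * s) from hk), zero_mul]
  rw [setLIntegral_congr_fun measurableSet_Ioi h1, lintegral_tsum]
  · congr 1
    ext n
    rw [lintegral_mul_const']
    · congr 1
      rw [lintegral_indicator measurableSet_Ici, Measure.restrict_restrict measurableSet_Ici]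
      have : (volume.restrict (Ici ((n:ℝ) * s) ∩ Ioi 0)) = volume.restrict (Ioi ((n:ℝ) * s)) := by
        apply Measure.restrict_congr_set
        have hns : (0:ℝ) ≤ n * s := by positivity
        have e : Ioi ((n:ℝ) * s) = Ioi ((n:ℝ) * s) ∩ Ioi 0 := by
          ext y; simp only [mem_Ioi, mem_inter_iff]; constructor
          · intro h; exact ⟨h, by linarith⟩
          · exact fun h => h.1
        rw [e]
        exact (Ioi_ae_eq_Ici).symm.inter (ae_eq_refl _)
      rw [this, lint_exp, neg_mul]
    · exact ENNReal.ofReal_ne_top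
  · intro n
    refine AEMeasurable.mul_const ?_ _
    exact ((by fun_prop : Measurable fun x : ℝ => ENNReal.ofReal (Real.exp (-x))).indicator
      measurableSet_Ici).aemeasurable

/-- Karamata, Abelian direction. -/
lemma Q_asymp (h0 : ∀ k, 0 ≤ q k) (hq : 0 < q 0) (hanti : Antitone q) {β : ℝ} (hβ : 0 < β)
    (hrv : ∀ x : ℝ, 0 < x → Tendsto (fun n : ℕ => ww q ⌊x * n⌋₊ / ww q n) atTop (𝓝 (x ^ β))) :
    Tendsto (fun N : ℕ =>
      (∑' n : ℕ, ENNReal.ofReal (Real.exp (-(n:ℝ) * (N:ℝ)⁻¹)) * ENNReal.ofReal (q n)).toReal / ww q N)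
      atTop (𝓝 (Real.Gamma (β + 1))) := by
  have hmeas : ∀ N : ℕ, Measurable (fun x : ℝ => Real.exp (-x) * ww q (⌊x * N⌋₊ + 1)) := by
    intro N
    refine Measurable.mul (by fun_prop) ?_
    exact (measurable_from_top (f := fun n : ℕ => ww q (n+1))).comp
      (Nat.measurable_floor.comp (by fun_prop))
  have hwn : ∀ n, 0 ≤ ww q n := fun n => Finset.sum_nonneg fun k _ => h0 k
  have e : ∀ N : ℕ, 1 ≤ N →
      (∑' n : ℕ, ENNReal.ofReal (Real.exp (-(n:ℝ) * (N:ℝ)⁻¹)) * ENNReal.ofReal (q n)).toReal / ww q N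
      = ∫ x in Ioi (0:ℝ), Real.exp (-x) * ww q (⌊x * N⌋₊ + 1) / ww q N := by
    intro N hN
    have hN0 : (0:ℝ) < N := by exact_mod_cast hN
    rw [Q_eq h0 (by positivity), integral_div]
    congr 1
    simp only [div_inv_eq_mul]
    rw [integral_eq_lintegral_of_nonneg_ae]
    · exact Eventually.of_forall fun x => mul_nonneg (Real.exp_pos _).le (hwn _)
    · exact (hmeas N).aestronglyMeasurable
  have G : Real.Gamma (β + 1) = ∫ x in Ioi (0:ℝ), Real.exp (-x) * x ^ β := by
    rw [Real.Gamma_eq_integral (by linarith)]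
    simp
  rw [G]
  refine Tendsto.congr' (f₁ := fun N : ℕ =>
    ∫ x in Ioi (0:ℝ), Real.exp (-x) * ww q (⌊x * N⌋₊ + 1) / ww q N) ?_ ?_
  · filter_upwards [eventually_ge_atTop 1] with N hN
    exact (e N hN).symm
  apply tendsto_integral_filter_of_dominated_convergence
    (fun x => Real.exp (-x) * x ^ ((2:ℝ) - 1) + 2 * Real.exp (-x))
  · exact Eventually.of_forall fun N => ((hmeas N).div_const _).aestronglyMeasurable
  · filter_upwards [eventually_ge_atTop 1] with N hN
    rw [ae_restrict_iff' measurableSet_Ioi]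
    refine Eventually.of_forall fun x hx => ?_
    have hx : 0 < x := hx
    have wN := ww_pos h0 hq hN
    have hN0 : (1:ℝ) ≤ N := by exact_mod_cast hN
    rw [Real.norm_of_nonneg (by have := hwn (⌊x * N⌋₊ + 1); positivity)]
    have hb := (ww_ratio_bounds h0 hq hanti (a := ⌊x * N⌋₊ + 1) (by omega) hN).2
    have hb2 : max 1 (((⌊x * N⌋₊ + 1 : ℕ):ℝ) / N) ≤ x + 2 := by
      apply max_le (by linarith)
      rw [div_le_iff₀ (by linarith)]
      push_cast
      have := Nat.floor_le (a := x * N) (by positivity)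
      nlinarith
    rw [mul_div_assoc]
    have h21 : x ^ ((2:ℝ)-1) = x := by norm_num
    rw [h21]
    calc _ ≤ Real.exp (-x) * (x+2) := by
          apply mul_le_mul_of_nonneg_left (hb.trans hb2) (Real.exp_pos _).le
      _ = _ := by ring
  · apply Integrable.add
    · exact Real.GammaIntegral_convergent (by norm_num)
    · apply Integrable.const_mul
      exact int_exp 0
  · rw [ae_restrict_iff' measurableSet_Ioi]
    refine Eventually.of_forall fun x hx => ?_
    have hx : 0 < x := hx
    simp only [mul_div_assoc]
    apply Tendsto.const_mul
    have h1 := hrv x hx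
    have h2 : Tendsto (fun n : ℕ => ww q (⌊x * n⌋₊ + 1) / ww q ⌊x * n⌋₊) atTop (𝓝 1) := by
      apply ww_ratio_one h0 hq hanti (Eventually.of_forall fun n => by omega)
        ((floor_tendsto hx).eventually_ge_atTop 1)
      have := (tendsto_const_nhds (x := (1:ℝ))).add
        (tendsto_one_div_atTop_nhds_zero_nat.comp (floor_tendsto hx))
      rw [add_zero] at this
      refine this.congr' ?_
      filter_upwards [(floor_tendsto hx).eventually_ge_atTop 1] with n hn
      have : (0:ℝ) < (⌊x * n⌋₊:ℕ) := by exact_mod_cast hn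
      simp only [Function.comp]
      push_cast
      field_simp
    have h3 := h2.mul h1
    rw [one_mul] at h3
    refine h3.congr' ?_
    filter_upwards [(floor_tendsto hx).eventually_ge_atTop 1] with n hn
    have := ww_pos h0 hq hn
    field_simp

end ana

section taub
variable {q : ℕ → ℝ}

/-- The relations between `I k = ∫_Y z^{S_k}`, `p = 1 - z` and the wandering rate. -/
def Good (w : ℕ → ℝ) (C p : ℝ) (I : ℕ → ℝ) : Prop :=
  0 < p ∧ (∀ k, 0 ≤ I k) ∧ Antitone I ∧ ∀ m n, m ≤ n →
    p * ∑ k ∈ Finset.range n, I k ≤ w n ∧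
    w n - p * ∑ k ∈ Finset.range n, I k ≤ C * w m * I (n - m) + (w n - w m)

lemma claim1 (h0 : ∀ k, 0 ≤ q k) (hq : 0 < q 0) {β : ℝ}
    (hrv : ∀ x : ℝ, 0 < x → Tendsto (fun n : ℕ => ww q ⌊x * n⌋₊ / ww q n) atTop (𝓝 (x ^ β)))
    {C : ℝ} (hC : 0 ≤ C) {p : ℕ → ℝ} {I : ℕ → ℕ → ℝ}
    (hgood : ∀ᶠ n in atTop, Good (ww q) C (p n) (I n))
    (hgrow : Tendsto (fun n : ℕ => ww q n / (n * p n)) atTop (𝓝 0)) {x : ℝ} (hx : 0 < x) :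
    Tendsto (fun n : ℕ => p n * (∑ k ∈ Finset.range ⌊x * n⌋₊, I n k) / ww q n)
      atTop (𝓝 (x ^ β)) := by
  have hc : ContinuousAt (fun y : ℝ => y ^ β) x := Real.continuousAt_rpow_const x β (Or.inl hx.ne')
  rw [tendsto_order]
  constructor
  · intro a ha
    have h1 : ∀ᶠ y in 𝓝 x, a < y ^ β ∧ 0 < y := (hc.eventually_const_lt ha).and (lt_mem_nhds hx)
    obtain ⟨c, hcx, hc'⟩ := exists_Ioc_subset_of_mem_nhds h1 ⟨x - 1, by linarith⟩
    obtain ⟨y, hy1, hy2⟩ := exists_between hcx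
    obtain ⟨hy3, hy4⟩ := hc' ⟨hy1, hy2.le⟩
    have hxy : 0 < x - y := by linarith
    have hM := (floor_tendsto hxy).eventually_ge_atTop 1
    have e1 : Tendsto (fun n : ℕ => (ww q ⌊(x-y) * n⌋₊ / ww q n) * (ww q n / (n * p n))
        * ((⌊(x-y) * n⌋₊ : ℝ) / n)⁻¹) atTop (𝓝 0) := by
      have := ((hrv _ hxy).mul hgrow).mul ((floor_div_tendsto hxy).inv₀ hxy.ne')
      simpa using this
    have e2 := (hrv y hy4).mul ((e1.const_mul C).const_sub 1)
    rw [mul_zero, sub_zero, mul_one] at e2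
    filter_upwards [e2.eventually_const_lt hy3, hgood, hM, eventually_ge_atTop 1] with n hn hg hM hn1
    obtain ⟨gp, gI, gA, gR⟩ := hg
    have wn := ww_pos h0 hq hn1
    have n0 : (0:ℝ) < n := by exact_mod_cast hn1
    set M := ⌊(x-y) * n⌋₊ with hMdef
    set m := ⌊y * n⌋₊ with hmdef
    set N := ⌊x * n⌋₊ with hNdef
    have M0 : (0:ℝ) < M := by exact_mod_cast hM
    have hmN : m + M ≤ N := by
      rw [hNdef, Nat.le_floor_iff (by positivity)]
      push_cast
      have := Nat.floor_le (a := y * n) (by positivity)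
      have := Nat.floor_le (a := (x-y) * n) (by positivity)
      linarith
    have hIM : I n M ≤ (ww q M / ww q n) * (ww q n / (n * p n)) * ((M : ℝ) / n)⁻¹ := by
      have : (ww q M / ww q n) * (ww q n / (n * p n)) * ((M : ℝ) / n)⁻¹ = ww q M / (p n * M) := by
        field_simp
      rw [this, le_div_iff₀ (by positivity)]
      have s1 := (gR 0 M (Nat.zero_le _)).1
      have s2 := Finset.card_nsmul_le_sum (Finset.range M) (I n) (I n M)
        (fun k hk => gA (Finset.mem_range.1 hk).le)
      rw [Finset.card_range, nsmul_eq_mul] at s2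
      nlinarith [mul_le_mul_of_nonneg_left s2 gp.le]
    have s3 := (gR m N (by omega)).2
    have s4 : I n (N - m) ≤ I n M := gA (by omega)
    have wm : 0 ≤ ww q m := Finset.sum_nonneg fun k _ => h0 k
    refine hn.trans_le ?_
    rw [div_mul_eq_mul_div]
    apply div_le_div_of_nonneg_right _ wn.le
    have s5 : C * ww q m * I n (N-m) ≤
        ww q m * (C * ((ww q M / ww q n) * (ww q n / (n * p n)) * ((M : ℝ) / n)⁻¹)) := by
      calc C * ww q m * I n (N-m) ≤ C * ww q m
            * ((ww q M / ww q n) * (ww q n / (n * p n)) * ((M : ℝ) / n)⁻¹) :=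
            mul_le_mul_of_nonneg_left (s4.trans hIM) (by positivity)
        _ = _ := by ring
    rw [mul_sub, mul_one]
    linarith
  · intro a ha
    filter_upwards [(hrv x hx).eventually_lt_const ha, hgood, eventually_ge_atTop 1] with n hn hg hn1
    have wn := ww_pos h0 hq hn1
    refine lt_of_le_of_lt ?_ hn
    gcongr
    exact (hg.2.2.2 0 _ (Nat.zero_le _)).1

lemma claim2 (h0 : ∀ k, 0 ≤ q k) (hq : 0 < q 0) {β : ℝ}
    (hrv : ∀ x : ℝ, 0 < x → Tendsto (fun n : ℕ => ww q ⌊x * n⌋₊ / ww q n) atTop (𝓝 (x ^ β)))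
    {C : ℝ} (hC : 0 ≤ C) {p : ℕ → ℝ} {I : ℕ → ℕ → ℝ}
    (hgood : ∀ᶠ n in atTop, Good (ww q) C (p n) (I n))
    (hgrow : Tendsto (fun n : ℕ => ww q n / (n * p n)) atTop (𝓝 0)) :
    Tendsto (fun n : ℕ => n * p n * I n n / ww q n) atTop (𝓝 β) := by
  have A := fun (x : ℝ) (hx : 0 < x) => claim1 h0 hq hrv hC hgood hgrow hx
  have hder : Tendsto (slope (fun y : ℝ => y ^ β) 1) (𝓝[≠] 1) (𝓝 β) := by
    have := Real.hasDerivAt_rpow_const (x := 1) (p := β) (Or.inl one_ne_zero)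
    rw [hasDerivAt_iff_tendsto_slope] at this
    simpa using this
  have A1 := A 1 one_pos
  have S : ∀ y : ℝ, 0 < y → y ≠ 1 → Tendsto (fun n : ℕ =>
      (p n * (∑ k ∈ Finset.range ⌊y * n⌋₊, I n k) / ww q n
        - p n * (∑ k ∈ Finset.range ⌊(1:ℝ) * n⌋₊, I n k) / ww q n) / ((⌊y * n⌋₊ : ℝ)/n - 1)) atTop
      (𝓝 (slope (fun y : ℝ => y ^ β) 1 y)) := by
    intro y hy hy1
    have := ((A y hy).sub A1).div ((floor_div_tendsto hy).sub_const 1) (sub_ne_zero.2 hy1)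
    rw [slope_def_field]
    exact this
  rw [tendsto_order]
  constructor
  · intro a ha
    have h1 : ∀ᶠ y in 𝓝[>] (1:ℝ), a < slope (fun y : ℝ => y ^ β) 1 y :=
      (hder.mono_left (nhdsWithin_mono _ fun y hy => ne_of_gt hy)).eventually_const_lt ha
    obtain ⟨y, hy1, hy2⟩ := (h1.and self_mem_nhdsWithin).exists
    have hy2 : 1 < y := hy2
    have hy0 : 0 < y := by linarith
    have hfl := (floor_div_tendsto hy0).eventually_const_lt hy2
    filter_upwards [(S y hy0 hy2.ne').eventually_const_lt hy1, hgood, hfl, eventually_ge_atTop 1]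
      with n hn hg hf hn1
    have wn := ww_pos h0 hq hn1
    have n0 : (0:ℝ) < n := by exact_mod_cast hn1
    refine hn.trans_le ?_
    rw [one_mul, Nat.floor_natCast]
    set N := ⌊y * n⌋₊
    rw [div_le_iff₀ (by linarith)]
    rw [lt_div_iff₀ n0, one_mul] at hf
    have hnN : n ≤ N := by exact_mod_cast hf.le
    rw [← Finset.sum_range_add_sum_Ico _ hnN]
    have s2 := Finset.sum_le_card_nsmul (Finset.Ico n N) (I n) (I n n)
      (fun k hk => hg.2.2.1 (Finset.mem_Ico.1 hk).1)
    rw [Nat.card_Ico, nsmul_eq_mul, Nat.cast_sub hnN] at s2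
    have e : ↑n * p n * I n n / ww q n * (↑N / ↑n - 1) = p n * ((N - n) * I n n) / ww q n := by
      field_simp
    rw [e, ← sub_div, ← mul_sub, add_sub_cancel_left]
    have := hg.1
    gcongr
  · intro a ha
    have h1 : ∀ᶠ y in 𝓝[<] (1:ℝ), slope (fun y : ℝ => y ^ β) 1 y < a :=
      (hder.mono_left (nhdsWithin_mono _ fun y hy => ne_of_lt hy)).eventually_lt_const ha
    have h2 : ∀ᶠ y in 𝓝[<] (1:ℝ), 0 < y := nhdsWithin_le_nhds (lt_mem_nhds one_pos)
    obtain ⟨y, ⟨hy1, hy0⟩, hy2⟩ := ((h1.and h2).and self_mem_nhdsWithin).exists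
    have hy2 : y < 1 := hy2
    have hfl := (floor_div_tendsto hy0).eventually_lt_const hy2
    filter_upwards [(S y hy0 hy2.ne).eventually_lt_const hy1, hgood, hfl, eventually_ge_atTop 1]
      with n hn hg hf hn1
    have wn := ww_pos h0 hq hn1
    have n0 : (0:ℝ) < n := by exact_mod_cast hn1
    refine lt_of_le_of_lt ?_ hn
    rw [one_mul, Nat.floor_natCast]
    set N := ⌊y * n⌋₊
    rw [le_div_iff_of_neg (by linarith)]
    rw [div_lt_iff₀ n0, one_mul] at hf
    have hnN : N ≤ n := by exact_mod_cast hf.le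
    rw [← Finset.sum_range_add_sum_Ico _ hnN]
    have s2 := Finset.card_nsmul_le_sum (Finset.Ico N n) (I n) (I n n)
      (fun k hk => hg.2.2.1 (Finset.mem_Ico.1 hk).2.le)
    rw [Nat.card_Ico, nsmul_eq_mul, Nat.cast_sub hnN] at s2
    have e : ↑n * p n * I n n / ww q n * (↑N / ↑n - 1) = -(p n * ((n - N) * I n n) / ww q n) := by
      field_simp
      ring
    rw [e, ← sub_div, ← mul_sub, sub_add_cancel_left, mul_neg, neg_div, neg_le_neg_iff]
    have := hg.1
    gcongr

end taub

section karamata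
variable {X : Type*} [MeasurableSpace X] {ρ : Measure X} [IsFiniteMeasure ρ]

lemma int_aux {f : X → ℝ} (hf : Measurable f) (hf01 : ∀ x, f x ∈ Icc (0:ℝ) 1)
    {g : ℝ → ℝ} (hg : Continuous g) : Integrable (fun x => f x * g (f x)) ρ := by
  have hc : Continuous (fun y => y * g y) := continuous_id.mul hg
  obtain ⟨B, hB⟩ := (isCompact_Icc (a := (0:ℝ)) (b := 1)).exists_bound_of_continuousOn
    hc.continuousOn
  refine Integrable.of_bound (hc.measurable.comp hf).aestronglyMeasurable B ?_
  exact Eventually.of_forall fun x => hB _ (hf01 x)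

lemma kar_poly {f : ℕ → X → ℝ} (hf : ∀ n, Measurable (f n)) (hf01 : ∀ n x, f n x ∈ Icc (0:ℝ) 1)
    {c : ℕ → ℝ} (hmom : ∀ j : ℕ, Tendsto (fun n => c n * ∫ x, f n x ^ (j+1) ∂ρ) atTop
      (𝓝 (1/((j:ℝ)+1)))) (P : Polynomial ℝ) :
    Tendsto (fun n => c n * ∫ x, f n x * P.eval (f n x) ∂ρ) atTop (𝓝 (∫ y in (0:ℝ)..1, P.eval y)) := by
  induction P using Polynomial.induction_on' with
  | add P Q hP hQ =>
    have e : ∀ n, c n * ∫ x, f n x * (P + Q).eval (f n x) ∂ρ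
        = c n * ∫ x, f n x * P.eval (f n x) ∂ρ + c n * ∫ x, f n x * Q.eval (f n x) ∂ρ := by
      intro n
      rw [← mul_add, ← integral_add (int_aux (hf n) (hf01 n) P.continuous)
        (int_aux (hf n) (hf01 n) Q.continuous)]
      simp only [Polynomial.eval_add, mul_add]
    simp only [e]
    simp only [Polynomial.eval_add]
    rw [intervalIntegral.integral_add (P.continuous.intervalIntegrable _ _)
      (Q.continuous.intervalIntegrable _ _)]
    exact hP.add hQ
  | monomial j a =>
    simp only [Polynomial.eval_monomial]
    have := (hmom j).const_mul a
    rw [intervalIntegral.integral_const_mul, integral_pow]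
    simp only [one_pow, ne_eq, Nat.succ_ne_zero, not_false_eq_true, zero_pow, sub_zero]
    refine this.congr fun n => ?_
    have e : ∀ x, f n x * (a * f n x ^ j) = a * f n x ^ (j+1) := fun x => by ring
    simp only [e, integral_const_mul]
    ring

lemma kar_cont {f : ℕ → X → ℝ} (hf : ∀ n, Measurable (f n)) (hf01 : ∀ n x, f n x ∈ Icc (0:ℝ) 1)
    {c : ℕ → ℝ} (hc : ∀ᶠ n in atTop, 0 ≤ c n)
    (hmom : ∀ j : ℕ, Tendsto (fun n => c n * ∫ x, f n x ^ (j+1) ∂ρ) atTop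
      (𝓝 (1/((j:ℝ)+1)))) {g : ℝ → ℝ} (hg : Continuous g) :
    Tendsto (fun n => c n * ∫ x, f n x * g (f n x) ∂ρ) atTop (𝓝 (∫ y in (0:ℝ)..1, g y)) := by
  rw [Metric.tendsto_atTop']
  intro ε hε
  obtain ⟨P, hP⟩ := exists_polynomial_near_of_continuousOn 0 1 g hg.continuousOn (ε/4) (by positivity)
  have h1 := kar_poly hf hf01 hmom P
  have h2 := hmom 0
  simp only [zero_add, pow_one, Nat.cast_zero, div_one] at h2
  have h3 := h2.eventually_lt_const (show (1:ℝ) < 2 by norm_num)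
  have h4 := Metric.tendsto_nhds.1 h1 (ε/4) (by positivity)
  have hI : |(∫ y in (0:ℝ)..1, P.eval y) - ∫ y in (0:ℝ)..1, g y| ≤ ε/4 := by
    rw [← intervalIntegral.integral_sub (P.continuous.intervalIntegrable _ _)
      (hg.intervalIntegrable _ _)]
    have := intervalIntegral.norm_integral_le_of_norm_le_const (a := (0:ℝ)) (b := 1) (C := ε/4)
      (f := fun y => P.eval y - g y) (fun y hy => by
        rw [uIoc_of_le zero_le_one] at hy
        exact (hP y ⟨hy.1.le, hy.2⟩).le)
    simpa using this
  have h5 : ∀ᶠ n in atTop, dist (c n * ∫ x, f n x * g (f n x) ∂ρ) (∫ y in (0:ℝ)..1, g y) < ε := by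
    filter_upwards [hc, h3, h4] with n hcn hn3 hn4
    have hif : Integrable (f n) ρ := by
      simpa using int_aux (ρ := ρ) (hf n) (hf01 n) (continuous_const (y := (1:ℝ)))
    have hD : |c n * ∫ x, f n x * g (f n x) ∂ρ - c n * ∫ x, f n x * P.eval (f n x) ∂ρ| ≤ ε/2 := by
      rw [← mul_sub, ← integral_sub (int_aux (hf n) (hf01 n) hg)
        (int_aux (hf n) (hf01 n) P.continuous), abs_mul, abs_of_nonneg hcn]
      have : |∫ x, (f n x * g (f n x) - f n x * P.eval (f n x)) ∂ρ| ≤ ∫ x, f n x * (ε/4) ∂ρ := by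
        have := norm_integral_le_of_norm_le (μ := ρ) (hif.mul_const (ε/4))
          (f := fun x => f n x * g (f n x) - f n x * P.eval (f n x))
          (Eventually.of_forall fun x => by
            rw [← mul_sub, norm_mul, Real.norm_of_nonneg (hf01 n x).1]
            apply mul_le_mul_of_nonneg_left _ (hf01 n x).1
            rw [Real.norm_eq_abs, abs_sub_comm]
            exact (hP _ (hf01 n x)).le)
        simpa using this
      calc _ ≤ c n * ∫ x, f n x * (ε/4) ∂ρ := mul_le_mul_of_nonneg_left this hcn
        _ = (c n * ∫ x, f n x ∂ρ) * (ε/4) := by rw [integral_mul_const]; ring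
        _ ≤ 2 * (ε/4) := by gcongr
        _ = _ := by ring
    rw [Real.dist_eq] at hn4 ⊢
    rw [abs_le] at hD hI
    rw [abs_lt] at hn4 ⊢
    constructor <;> linarith [hD.1, hD.2, hI.1, hI.2, hn4.1, hn4.2]
  obtain ⟨N, hN⟩ := eventually_atTop.1 h5
  exact ⟨N, fun n hn => hN n hn.le⟩

/-- linear cutoff -/
noncomputable def cut (b δ y : ℝ) : ℝ := min 1 (max 0 ((y - b)/δ)) / max y (Real.exp (-1))

lemma cut_cont (b δ : ℝ) : Continuous (cut b δ) := by
  unfold cut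
  apply Continuous.div
  · fun_prop
  · fun_prop
  · intro y
    have : 0 < max y (Real.exp (-1)) := lt_max_of_lt_right (Real.exp_pos _)
    exact this.ne'

lemma cut_nonneg (b δ y : ℝ) : 0 ≤ cut b δ y := by
  unfold cut
  have : 0 < max y (Real.exp (-1)) := lt_max_of_lt_right (Real.exp_pos _)
  positivity

lemma cut_le (b δ y : ℝ) : cut b δ y ≤ 1 / max y (Real.exp (-1)) := by
  unfold cut
  have : 0 < max y (Real.exp (-1)) := lt_max_of_lt_right (Real.exp_pos _)
  gcongr
  exact min_le_left _ _

lemma cut_zero {b δ y : ℝ} (hδ : 0 < δ) (h : y ≤ b) : cut b δ y = 0 := by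
  unfold cut
  have : (y - b)/δ ≤ 0 := div_nonpos_of_nonpos_of_nonneg (by linarith) hδ.le
  rw [max_eq_left this]; simp

lemma cut_one {b δ y : ℝ} (hδ : 0 < δ) (h : b + δ ≤ y) :
    cut b δ y = 1 / max y (Real.exp (-1)) := by
  unfold cut
  have : 1 ≤ (y - b)/δ := by rw [le_div_iff₀ hδ]; linarith
  rw [max_eq_right (by linarith), min_eq_left this]

lemma exp_neg_one_lt : Real.exp (-1) < 1/2 := by
  have := Real.exp_one_gt_d9
  rw [Real.exp_neg, ← one_div]
  apply one_div_lt_one_div_of_lt <;> linarith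

lemma cut_int_upper {δ : ℝ} (hδ : 0 < δ) (hδ' : δ < Real.exp (-1)) :
    ∫ y in (0:ℝ)..1, cut (Real.exp (-1) - δ) δ y ≤ 1 + δ * (1 / Real.exp (-1)) := by
  set b := Real.exp (-1) with hb
  have hb0 : 0 < b := Real.exp_pos _
  have hb1 := exp_neg_one_lt
  have hi : ∀ u v : ℝ, IntervalIntegrable (cut (b-δ) δ) volume u v :=
    fun u v => (cut_cont _ _).intervalIntegrable _ _
  rw [← intervalIntegral.integral_add_adjacent_intervals (hi 0 (b-δ)) (hi (b-δ) 1),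
    ← intervalIntegral.integral_add_adjacent_intervals (hi (b-δ) b) (hi b 1)]
  have e1 : ∫ y in (0:ℝ)..(b-δ), cut (b-δ) δ y = 0 := by
    rw [intervalIntegral.integral_congr (g := fun _ => (0:ℝ))]
    · simp
    · intro y hy
      rw [uIcc_of_le (by linarith)] at hy
      exact cut_zero hδ hy.2
  have e2 : ∫ y in (b-δ)..b, cut (b-δ) δ y ≤ δ * (1/b) := by
    calc _ ≤ ∫ y in (b-δ)..b, (1/b) := by
          apply intervalIntegral.integral_mono_on (by linarith) (hi _ _) (by simp)
          intro y hy
          exact (cut_le _ _ _).trans (one_div_le_one_div_of_le hb0 (le_max_right _ _))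
      _ = _ := by simp
  have e3 : ∫ y in b..1, cut (b-δ) δ y = 1 := by
    rw [intervalIntegral.integral_congr (g := fun y => 1/y)]
    · rw [integral_one_div_of_pos hb0 one_pos, hb, one_div, ← Real.exp_neg]; simp
    · intro y hy
      rw [uIcc_of_le (by linarith)] at hy
      simp only
      rw [cut_one hδ (by linarith [hy.1]), max_eq_left hy.1]
  linarith

lemma cut_int_lower {δ : ℝ} (hδ : 0 < δ) (hδ' : δ < 1/2) :
    1 - δ * (1 / Real.exp (-1)) ≤ ∫ y in (0:ℝ)..1, cut (Real.exp (-1)) δ y := by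
  set b := Real.exp (-1) with hb
  have hb0 : 0 < b := Real.exp_pos _
  have hb1 := exp_neg_one_lt
  have hi : ∀ u v : ℝ, IntervalIntegrable (cut b δ) volume u v :=
    fun u v => (cut_cont _ _).intervalIntegrable _ _
  have hj : ∀ u v : ℝ, IntervalIntegrable (fun y => 1 / max y b) volume u v := by
    intro u v
    refine Continuous.intervalIntegrable (continuous_const.div (by fun_prop) ?_) _ _
    intro y
    have : 0 < max y b := lt_max_of_lt_right hb0
    exact this.ne'
  rw [← intervalIntegral.integral_add_adjacent_intervals (hi 0 (b+δ)) (hi (b+δ) 1)]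
  have e1 : 0 ≤ ∫ y in (0:ℝ)..(b+δ), cut b δ y :=
    intervalIntegral.integral_nonneg (by linarith) fun y _ => cut_nonneg _ _ _
  have e2 : ∫ y in (b+δ)..1, cut b δ y = ∫ y in (b+δ)..1, 1 / max y b := by
    apply intervalIntegral.integral_congr
    intro y hy
    rw [uIcc_of_le (by linarith)] at hy
    exact cut_one hδ hy.1
  have e3 : ∫ y in b..1, 1 / max y b = 1 := by
    rw [intervalIntegral.integral_congr (g := fun y => 1/y)]
    · rw [integral_one_div_of_pos hb0 one_pos, hb, one_div, ← Real.exp_neg]; simp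
    · intro y hy
      rw [uIcc_of_le (by linarith)] at hy
      simp only
      rw [max_eq_left hy.1]
  rw [← intervalIntegral.integral_add_adjacent_intervals (hj b (b+δ)) (hj (b+δ) 1)] at e3
  have e4 : ∫ y in b..(b+δ), 1 / max y b ≤ δ * (1/b) := by
    calc _ ≤ ∫ y in b..(b+δ), (1/b) := by
          apply intervalIntegral.integral_mono_on (by linarith) (hj _ _) (by simp)
          intro y hy
          exact (one_div_le_one_div_of_le hb0 (le_max_right _ _))
      _ = _ := by simp
  linarith

lemma kar_final {f : ℕ → X → ℝ} (hf : ∀ n, Measurable (f n)) (hf01 : ∀ n x, f n x ∈ Icc (0:ℝ) 1)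
    {c : ℕ → ℝ} (hc : ∀ᶠ n in atTop, 0 ≤ c n)
    (hmom : ∀ j : ℕ, Tendsto (fun n => c n * ∫ x, f n x ^ (j+1) ∂ρ) atTop
      (𝓝 (1/((j:ℝ)+1)))) :
    Tendsto (fun n => c n * (ρ {x | Real.exp (-1) ≤ f n x}).toReal) atTop (𝓝 1) := by
  set b := Real.exp (-1) with hb
  have hb0 : 0 < b := Real.exp_pos _
  have hb1 : b < 1/2 := exp_neg_one_lt
  have hS : ∀ n, MeasurableSet {x | b ≤ f n x} := fun n => measurableSet_le measurable_const (hf n)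
  have hmeq : ∀ n, (ρ {x | b ≤ f n x}).toReal
      = ∫ x, ({x | b ≤ f n x} : Set X).indicator (fun _ => (1:ℝ)) x ∂ρ := by
    intro n
    rw [integral_indicator (hS n)]
    simp [Measure.real]
  have hint : ∀ n, Integrable (({x | b ≤ f n x} : Set X).indicator (fun _ => (1:ℝ))) ρ :=
    fun n => (integrable_const _).indicator (hS n)
  have hK := fun (b' δ : ℝ) => kar_cont hf hf01 hc hmom (cut_cont b' δ)
  have small : ∀ r : ℝ, 0 < r → ∃ δ, 0 < δ ∧ δ < b ∧ δ * (1/b) < r := by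
    intro r hr
    refine ⟨min (b/2) (r * b / 2), by positivity, ?_, ?_⟩
    · exact (min_le_left _ _).trans_lt (by linarith)
    · calc _ ≤ (r * b / 2) * (1/b) := by gcongr; exact min_le_right _ _
        _ = r/2 := by field_simp
        _ < r := by linarith
  rw [tendsto_order]
  constructor
  · intro a ha
    obtain ⟨δ, h1, h2, h3⟩ := small (1 - a) (by linarith)
    have h4 := cut_int_lower h1 (by linarith : δ < 1/2)
    filter_upwards [(hK b δ).eventually_const_lt (show a < _ by linarith), hc] with n hn hcn
    refine hn.trans_le ?_
    rw [hmeq n]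
    apply mul_le_mul_of_nonneg_left _ hcn
    apply integral_mono (int_aux (hf n) (hf01 n) (cut_cont b δ)) (hint n)
    intro x
    by_cases hx : b ≤ f n x
    · rw [indicator_of_mem (show x ∈ {x | b ≤ f n x} from hx)]
      have := cut_le b δ (f n x)
      rw [max_eq_left hx] at this
      have hp : 0 < f n x := by linarith
      calc f n x * cut b δ (f n x) ≤ f n x * (1 / f n x) := by gcongr
        _ = 1 := by field_simp
    · rw [indicator_of_notMem (show x ∉ {x | b ≤ f n x} from hx)]
      simp only
      rw [cut_zero h1 (not_le.1 hx).le, mul_zero]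
  · intro a ha
    obtain ⟨δ, h1, h2, h3⟩ := small (a - 1) (by linarith)
    have h4 := cut_int_upper h1 h2
    filter_upwards [(hK (b-δ) δ).eventually_lt_const (show _ < a by linarith), hc] with n hn hcn
    refine lt_of_le_of_lt ?_ hn
    rw [hmeq n]
    apply mul_le_mul_of_nonneg_left _ hcn
    apply integral_mono (hint n) (int_aux (hf n) (hf01 n) (cut_cont (b-δ) δ))
    intro x
    by_cases hx : b ≤ f n x
    · rw [indicator_of_mem (show x ∈ {x | b ≤ f n x} from hx)]
      simp only
      rw [cut_one h1 (by linarith), max_eq_left hx]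
      have hp : 0 < f n x := by linarith
      apply le_of_eq
      field_simp
    · rw [indicator_of_notMem (show x ∉ {x | b ≤ f n x} from hx)]
      exact mul_nonneg (hf01 n x).1 (cut_nonneg _ _ _)

end karamata

section final
variable {X : Type*} [MeasurableSpace X] {μ : Measure X} {T : X → X} {Y : Set X}

lemma qk_le (k : ℕ) : qk T Y μ k ≤ μ Y := measure_mono inter_subset_left

lemma qk_ne_top (hY1 : μ Y < ⊤) (k : ℕ) : qk T Y μ k ≠ ⊤ := ((qk_le k).trans_lt hY1).ne

lemma qk_anti : Antitone (qk T Y μ) := by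
  intro m n h
  apply measure_mono
  rintro x ⟨h1, h2⟩
  exact ⟨h1, fun j hj hj' => h2 j hj (hj'.trans h)⟩

lemma qk_zero : qk T Y μ 0 = μ Y := by
  have : NV T Y 0 = univ := by
    ext x; simp only [NV, mem_ofPred_eq, mem_univ, iff_true]; intro j h1 h2; omega
  simp [qk, this]

lemma wrate_toReal (hY1 : μ Y < ⊤) (n : ℕ) :
    (wrate T Y μ n).toReal = ww (fun k => (qk T Y μ k).toReal) n := by
  rw [wrate_eq, ENNReal.toReal_sum fun k _ => qk_ne_top hY1 k, ww]

lemma rr_ne_top (hT : MeasurePreserving T μ μ) (hY : MeasurableSet Y) (hY1 : μ Y < ⊤)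
    {z : ℝ≥0∞} (hz : z ≤ 1) (k m : ℕ) : rr T Y μ z k m ≠ ⊤ := by
  have : rr T Y μ z k m ≤ qk T Y μ k := by
    rw [← measure_Ypart hT hY hY1, rr, ← setLIntegral_one]
    exact lintegral_mono fun x => pow_le_one' hz _
  exact (this.trans_lt (qk_ne_top hY1 k).lt_top).ne

lemma good_of (hT : MeasurePreserving T μ μ) (hY : MeasurableSet Y) (hY1 : μ Y < ⊤)
    {hatT : (X → ℝ≥0∞) → (X → ℝ≥0∞)}
    (hatTmeas : ∀ u, Measurable u → Measurable (hatT u))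
    (hatTdual : ∀ u v : X → ℝ≥0∞, Measurable u → Measurable v →
      ∫⁻ x, v (T x) * u x ∂μ = ∫⁻ x, v x * hatT u x ∂μ)
    {C : ℝ≥0∞} (hC : C ≠ ⊤) (hB3 : ∀ n : ℕ, 1 ≤ n → ∀ᵐ x ∂μ,
      ∑ k ∈ Finset.range n, (hatT^[k] ((Ypart T Y k).indicator fun _ => (1:ℝ≥0∞))) x
        ≤ C * wrate T Y μ n) {z : ℝ} (hz0 : 0 < z) (hz1 : z < 1) :
    Good (ww (fun k => (qk T Y μ k).toReal)) C.toReal (1 - z)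
      (fun k => (rr T Y μ (ENNReal.ofReal z) 0 k).toReal) := by
  have hz : ENNReal.ofReal z ≤ 1 := by rw [ENNReal.ofReal_le_one]; exact hz1.le
  have hrt := rr_ne_top hT hY hY1 hz
  refine ⟨by linarith, fun k => ENNReal.toReal_nonneg, ?_, ?_⟩
  · intro m n h
    apply ENNReal.toReal_mono (hrt 0 m)
    apply lintegral_mono
    intro x
    exact pow_le_pow_right_of_le_one' hz (occ_mono h _)
  · intro m n hmn
    have hid := main_identity hT hY (ENNReal.ofReal z) (ENNReal.ofReal (1-z))
      (by rw [← ENNReal.ofReal_add (by linarith) hz0.le]; simp) n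
    have hb := rr_bound hT hY hY1 hatTmeas hatTdual hB3 (ENNReal.ofReal z) hz m n hmn
    have hS1 : ∑ j ∈ Finset.range n, rr T Y μ (ENNReal.ofReal z) 0 j ≠ ⊤ :=
      ENNReal.sum_ne_top.2 fun k _ => hrt _ _
    have hS2 : ∑ k ∈ Finset.range n, rr T Y μ (ENNReal.ofReal z) k (n-1-k) ≠ ⊤ :=
      ENNReal.sum_ne_top.2 fun k _ => hrt _ _
    have hwt : ∀ n, wrate T Y μ n ≠ ⊤ := fun n => by
      rw [wrate_eq]; exact ENNReal.sum_ne_top.2 fun k _ => qk_ne_top hY1 k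
    have hid' := congrArg ENNReal.toReal hid
    rw [ENNReal.toReal_add (ENNReal.mul_ne_top ENNReal.ofReal_ne_top hS1)
      (ENNReal.mul_ne_top ENNReal.ofReal_ne_top hS2), ENNReal.toReal_mul, ENNReal.toReal_mul,
      ENNReal.toReal_ofReal (by linarith), ENNReal.toReal_ofReal hz0.le, wrate_toReal hY1,
      ENNReal.toReal_sum (fun k _ => hrt _ _)] at hid'
    have hA : C * wrate T Y μ m * rr T Y μ (ENNReal.ofReal z) 0 (n - m) ≠ ⊤ :=
      ENNReal.mul_ne_top (ENNReal.mul_ne_top hC (hwt m)) (hrt _ _)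
    have hB : ∑ k ∈ Finset.Ico m n, qk T Y μ k ≠ ⊤ := ENNReal.sum_ne_top.2 fun k _ => qk_ne_top hY1 k
    have hb' := ENNReal.toReal_mono (ENNReal.add_ne_top.2 ⟨hA, hB⟩) hb
    rw [ENNReal.toReal_add hA hB, ENNReal.toReal_mul, ENNReal.toReal_mul, wrate_toReal hY1,
      ENNReal.toReal_sum (s := Finset.Ico m n) fun k _ => qk_ne_top hY1 k] at hb'
    have hw : ww (fun k => (qk T Y μ k).toReal) n = ww (fun k => (qk T Y μ k).toReal) m
        + ∑ k ∈ Finset.Ico m n, (qk T Y μ k).toReal := by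
      rw [ww, ww, Finset.sum_range_add_sum_Ico _ hmn]
    set R := (∑ k ∈ Finset.range n, rr T Y μ (ENNReal.ofReal z) k (n-1-k)).toReal
    have hR : 0 ≤ R := ENNReal.toReal_nonneg
    constructor
    · nlinarith
    · have : z * R ≤ R := by nlinarith
      linarith

lemma one_sub_exp_tendsto (c : ℝ) (hc : c ≠ 0) {A : ℕ → ℝ} (hA : Tendsto A atTop atTop) :
    Tendsto (fun n => (1 - Real.exp (-(c / A n))) * A n) atTop (𝓝 c) := by
  have h1 : Tendsto (slope Real.exp 0) (𝓝[≠] 0) (𝓝 1) := by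
    have := Real.hasDerivAt_exp 0
    rw [hasDerivAt_iff_tendsto_slope] at this
    simpa using this
  have h2 : Tendsto (fun n => -(c / A n)) atTop (𝓝[≠] 0) := by
    rw [tendsto_nhdsWithin_iff]
    constructor
    · simpa using (hA.const_div_atTop c).neg
    · filter_upwards [hA.eventually_gt_atTop 0] with n hn
      simp [hc, hn.ne']
  have h3 := (h1.comp h2).const_mul c
  rw [mul_one] at h3
  refine h3.congr' ?_
  filter_upwards [hA.eventually_gt_atTop 0] with n hn
  simp only [Function.comp, slope_def_field, Real.exp_zero]
  generalize Real.exp (-(c / A n)) = E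
  have hAn : A n ≠ 0 := hn.ne'
  have hne : -(c / A n) ≠ 0 := neg_ne_zero.2 (div_ne_zero hc hAn)
  rw [sub_zero, mul_div_assoc', div_eq_iff hne]
  have h5 : A n * (c / A n) = c := mul_div_cancel₀ c hAn
  linear_combination (1 - E) * h5

lemma gamma_const {α : ℝ} (hα : α ∈ Set.Ioo (0:ℝ) 1) :
    Real.sin (Real.pi * α) / (Real.pi * α)
      * (Real.Gamma (1 + α) * Real.Gamma (1 - α + 1) / (1 - α)) = 1 := by
  have h1 := Real.Gamma_mul_Gamma_one_sub α
  have h2 : Real.Gamma (1 + α) = α * Real.Gamma α := by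
    rw [add_comm]; exact Real.Gamma_add_one hα.1.ne'
  have h3 : Real.Gamma (1 - α + 1) = (1 - α) * Real.Gamma (1 - α) :=
    Real.Gamma_add_one (by linarith [hα.2])
  have hs : 0 < Real.sin (Real.pi * α) := by
    apply Real.sin_pos_of_pos_of_lt_pi
    · exact mul_pos Real.pi_pos hα.1
    · nlinarith [Real.pi_pos, hα.2]
  have hβ : 1 - α ≠ 0 := by linarith [hα.2]
  have hα0 := hα.1.ne'
  have hpi := Real.pi_ne_zero
  rw [h2, h3]
  have : α * Real.Gamma α * ((1 - α) * Real.Gamma (1 - α)) / (1 - α)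
      = α * (Real.Gamma α * Real.Gamma (1 - α)) := by field_simp
  rw [this, h1]
  field_simp

end final

end DK

/-- Large deviation estimate related to the Darling–Kac theorem:
`μ_{1_Y}(S_n^Y/a(n) ≤ c̃(n)) ~ (sin πα)/(πα) · c̃(n)`. -/
theorem stmt18 {X : Type*} [MeasurableSpace X] {μ : Measure X} [SigmaFinite μ]
    {T : X → X} (hcons : Conservative T μ) (herg : Ergodic T μ)
    (hinf : μ Set.univ = ⊤) {Y : Set X} (hYm : MeasurableSet Y)
    (hY0 : 0 < μ Y) (hY1 : μ Y < ⊤)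
    (hatT : (X → ℝ≥0∞) → (X → ℝ≥0∞))
    (hatTmeas : ∀ u, Measurable u → Measurable (hatT u))
    (hatTdual : ∀ u v : X → ℝ≥0∞, Measurable u → Measurable v →
      ∫⁻ x, v (T x) * u x ∂μ = ∫⁻ x, v x * hatT u x ∂μ)
    (α : ℝ) (hα : α ∈ Set.Ioo (0:ℝ) 1)
    (ℓ : ℝ → ℝ) (hℓmeas : Measurable ℓ) (hℓpos : ∀ t, 0 < t → 0 < ℓ t)
    (hℓsv : ∀ lam : ℝ, 0 < lam → Tendsto (fun t => ℓ (lam * t) / ℓ t) atTop (𝓝 1))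
    -- (B2): `w_n^Y ~ n^{1-α} ℓ(n)`
    (hw : Tendsto (fun n : ℕ => (wrate T Y μ n).toReal / ((n : ℝ) ^ (1 - α) * ℓ n))
      atTop (𝓝 1))
    -- (B3): `L^∞`-boundedness of the normalized entrance densities
    (hB3 : ∃ C : ℝ≥0∞, C ≠ ⊤ ∧ ∀ n : ℕ, 1 ≤ n → ∀ᵐ x ∂μ,
      ∑ k ∈ Finset.range n, (hatT^[k] ((Ypart T Y k).indicator fun _ => (1:ℝ≥0∞))) x
        ≤ C * wrate T Y μ n) :
    ∀ tc : ℕ → ℝ, (∀ n, 0 < tc n) → Tendsto tc atTop (𝓝 0) →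
      Tendsto (fun n : ℕ => tc n * aDK T Y μ α n) atTop atTop →
      Tendsto (fun n : ℕ =>
        (μ (Y ∩ {x | (occTime T Y n x : ℝ) ≤ tc n * aDK T Y μ α n})).toReal /
          (Real.sin (Real.pi * α) / (Real.pi * α) * tc n))
        atTop (𝓝 1) := by
  intro tc htc0 htc hA
  obtain ⟨C, hC, hB3⟩ := hB3
  have hT : MeasurePreserving T μ μ := herg.toMeasurePreserving
  have hβ : 0 < 1 - α := by linarith [hα.2]
  set q : ℕ → ℝ := fun k => (DK.qk T Y μ k).toReal with hqdef
  have h0 : ∀ k, 0 ≤ q k := fun k => ENNReal.toReal_nonneg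
  have hq : 0 < q 0 := by
    simp only [hqdef, DK.qk_zero]
    exact ENNReal.toReal_pos hY0.ne' hY1.ne
  have hanti : Antitone q := fun m n h => ENNReal.toReal_mono (DK.qk_ne_top hY1 m) (DK.qk_anti h)
  have hw' : Tendsto (fun n : ℕ => DK.ww q n / ((n : ℝ) ^ (1 - α) * ℓ n)) atTop (𝓝 1) := by
    refine hw.congr fun n => ?_
    rw [DK.wrate_toReal hY1]
  have hrv : ∀ x : ℝ, 0 < x →
      Tendsto (fun n : ℕ => DK.ww q ⌊x * n⌋₊ / DK.ww q n) atTop (𝓝 (x ^ (1 - α))) := fun x hx =>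
    DK.ww_rv h0 hq hanti (fun k hk => DK.ww_nat_rv hℓpos hℓsv hw' hk) hx
  have hQ := DK.Q_asymp h0 hq hanti hβ hrv
  have hQe : ∀ s : ℝ, QY T Y μ s
      = ∑' n : ℕ, ENNReal.ofReal (Real.exp (-(n:ℝ) * s)) * ENNReal.ofReal (q n) := by
    intro s
    simp only [QY, DK.NV_set, hqdef]
    congr 1
    ext n
    rw [ENNReal.ofReal_toReal (DK.qk_ne_top hY1 n), DK.qk]
  simp only [← hQe] at hQ
  have hΓ1 : 0 < Real.Gamma (1 + α) := Real.Gamma_pos_of_pos (by linarith [hα.1])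
  have hΓ2 : 0 < Real.Gamma (1 - α + 1) := Real.Gamma_pos_of_pos (by linarith)
  set A : ℕ → ℝ := fun n => tc n * aDK T Y μ α n with hAdef
  have hA0 : ∀ n, 0 ≤ A n := by
    intro n
    refine mul_nonneg (htc0 n).le ?_
    unfold aDK
    positivity
  set z : ℕ → ℝ := fun n => Real.exp (-(1 / A n)) with hzdef
  have hz0 : ∀ n, 0 < z n := fun n => Real.exp_pos _
  have hz1 : ∀ n, z n ≤ 1 := fun n => by
    rw [hzdef]; simp only [Real.exp_le_one_iff]
    have := hA0 n
    simp only [Left.neg_nonpos_iff]; positivity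
  have hApos := hA.eventually_gt_atTop 0
  have hz1' : ∀ᶠ n in atTop, z n < 1 := by
    filter_upwards [hApos] with n hn
    rw [hzdef]; simp only [Real.exp_lt_one_iff]
    simp only [Left.neg_neg_iff]; positivity
  -- `w_n a_n / n`
  have hwa : Tendsto (fun n : ℕ => DK.ww q n * aDK T Y μ α n / n) atTop
      (𝓝 ((Real.Gamma (1+α) * Real.Gamma (1 - α + 1))⁻¹)) := by
    have := (hQ.const_mul (Real.Gamma (1+α))).inv₀ (by positivity)
    refine this.congr' ?_
    filter_upwards [eventually_ge_atTop 1, hApos] with n hn hAn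
    have n0 : (0:ℝ) < n := by exact_mod_cast hn
    have wn := DK.ww_pos h0 hq hn
    unfold aDK
    field_simp
  have hPA : ∀ j : ℕ, Tendsto (fun n => (1 - z n ^ (j+1)) * A n) atTop (𝓝 ((j:ℝ)+1)) := by
    intro j
    refine (DK.one_sub_exp_tendsto ((j:ℝ)+1) (by positivity) hA).congr fun n => ?_
    rw [hzdef]
    simp only
    rw [← Real.exp_nat_mul]
    push_cast
    congr 3
    ring
  have hgrow : ∀ j : ℕ, Tendsto (fun n : ℕ => DK.ww q n / (n * (1 - z n ^ (j+1)))) atTop (𝓝 0) := by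
    intro j
    have := (htc.mul hwa).div (hPA j) (by positivity)
    rw [zero_mul, zero_div] at this
    refine this.congr' ?_
    filter_upwards [hApos, hz1', eventually_ge_atTop 1] with n hAn hzn hn
    have n0 : (0:ℝ) < n := by exact_mod_cast hn
    have hp : 0 < 1 - z n ^ (j+1) := by
      have : z n ^ (j+1) < 1 := pow_lt_one₀ (hz0 n).le hzn (Nat.succ_ne_zero j)
      linarith
    have e : A n = tc n * aDK T Y μ α n := rfl
    simp only [Pi.div_apply]
    rw [div_eq_div_iff (by positivity) (by positivity), e]
    field_simp
  have hcl : ∀ j : ℕ, Tendsto (fun n : ℕ => n * (1 - z n ^ (j+1)) *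
      (DK.rr T Y μ (ENNReal.ofReal (z n ^ (j+1))) 0 n).toReal / DK.ww q n) atTop (𝓝 (1 - α)) := by
    intro j
    refine DK.claim2 (I := fun n k => (DK.rr T Y μ (ENNReal.ofReal (z n ^ (j+1))) 0 k).toReal)
      h0 hq hrv (C := C.toReal) ENNReal.toReal_nonneg ?_ (hgrow j)
    filter_upwards [hz1'] with n hzn
    exact DK.good_of hT hYm hY1 hatTmeas hatTdual hC hB3 (pow_pos (hz0 n) _)
      (pow_lt_one₀ (hz0 n).le hzn (Nat.succ_ne_zero j))
  have : IsFiniteMeasure (μ.restrict Y) := ⟨by simpa using hY1⟩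
  have hfm : ∀ n, Measurable (fun x => z n ^ occTime T Y n x) := fun n =>
    (measurable_from_top (f := fun k : ℕ => z n ^ k)).comp (DK.meas_occ hT.measurable hYm n)
  have hmom : ∀ j : ℕ, Tendsto (fun n : ℕ => (n / ((1 - α) * DK.ww q n * A n))
      * ∫ x, (z n ^ occTime T Y n x) ^ (j+1) ∂(μ.restrict Y)) atTop (𝓝 (1/((j:ℝ)+1))) := by
    intro j
    have := (hcl j).div ((hPA j).const_mul (1 - α)) (by positivity)
    rw [show (1 - α) / ((1 - α) * ((j:ℝ)+1)) = 1/((j:ℝ)+1) by field_simp] at this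
    refine this.congr' ?_
    filter_upwards [hApos, hz1', eventually_ge_atTop 1] with n hAn hzn hn
    have n0 : (0:ℝ) < n := by exact_mod_cast hn
    have wn := DK.ww_pos h0 hq hn
    have hp : 0 < 1 - z n ^ (j+1) := by
      have : z n ^ (j+1) < 1 := pow_lt_one₀ (hz0 n).le hzn (Nat.succ_ne_zero j)
      linarith
    have e : ∫ x, (z n ^ occTime T Y n x) ^ (j+1) ∂(μ.restrict Y)
        = (DK.rr T Y μ (ENNReal.ofReal (z n ^ (j+1))) 0 n).toReal := by
      rw [integral_eq_lintegral_of_nonneg_ae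
        (Eventually.of_forall fun x => pow_nonneg (pow_nonneg (hz0 n).le _) _)
        ((hfm n).pow_const (j+1)).aestronglyMeasurable]
      congr 1
      simp only [DK.rr, Ypart, Function.iterate_zero, id]
      congr 1
      ext x
      rw [← ENNReal.ofReal_pow (pow_nonneg (hz0 n).le _), ← pow_mul, ← pow_mul, mul_comm]
    rw [e]
    simp only [Pi.div_apply]
    field_simp
  have hfin := DK.kar_final hfm
    (fun n x => ⟨pow_nonneg (hz0 n).le _, pow_le_one₀ (hz0 n).le (hz1 n)⟩)
    (c := fun n : ℕ => n / ((1 - α) * DK.ww q n * A n)) (by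
      filter_upwards with n
      have := hA0 n
      have : 0 ≤ DK.ww q n := Finset.sum_nonneg fun k _ => h0 k
      positivity) hmom
  have hct0 : Tendsto (fun n : ℕ => (n / ((1 - α) * DK.ww q n * A n) * tc n)) atTop
      (𝓝 (Real.Gamma (1 + α) * Real.Gamma (1 - α + 1) / (1 - α))) := by
    have := (hwa.inv₀ (by positivity)).div_const (1 - α)
    rw [inv_inv] at this
    refine this.congr' ?_
    filter_upwards [hApos, eventually_ge_atTop 1] with n hAn hn
    have n0 : (0:ℝ) < n := by exact_mod_cast hn
    have wn := DK.ww_pos h0 hq hn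
    have t0 := htc0 n
    have a0 : 0 < aDK T Y μ α n := pos_of_mul_pos_right hAn t0.le
    have e : A n = tc n * aDK T Y μ α n := rfl
    rw [e]
    field_simp
  have hct := hct0.const_mul (Real.sin (Real.pi * α) / (Real.pi * α))
  rw [DK.gamma_const hα] at hct
  have hres := hfin.div hct one_ne_zero
  rw [div_one] at hres
  refine hres.congr' ?_
  filter_upwards [hApos, eventually_ge_atTop 1] with n hAn hn
  have n0 : (0:ℝ) < n := by exact_mod_cast hn
  have wn := DK.ww_pos h0 hq hn
  have t0 := htc0 n
  have hset : (μ.restrict Y) {x | Real.exp (-1) ≤ z n ^ occTime T Y n x}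
      = μ (Y ∩ {x | (occTime T Y n x : ℝ) ≤ A n}) := by
    rw [Measure.restrict_apply (measurableSet_le measurable_const (hfm n)), inter_comm]
    congr 2
    ext x
    simp only [mem_ofPred_eq, hzdef]
    rw [← Real.exp_nat_mul, Real.exp_le_exp, mul_neg, neg_le_neg_iff, mul_one_div, div_le_one hAn]
  simp only [Pi.div_apply]
  rw [hset]
  have hc0 : (n : ℝ) / ((1 - α) * DK.ww q n * A n) ≠ 0 := by positivity
  rw [show Real.sin (Real.pi * α) / (Real.pi * α) * (n / ((1 - α) * DK.ww q n * A n) * tc n)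
    = (n / ((1 - α) * DK.ww q n * A n)) * (Real.sin (Real.pi * α) / (Real.pi * α) * tc n) by ring]
  exact mul_div_mul_left _ _ hc0
end

section
/- Assume the Darling–Kac setting (B1) and (B3) (CEMPT $T$ on an infinite $\sigma$-finite space, $0<\mu(Y)<\infty$, $\{(w_n^Y)^{-1}\sum_{k=0}^{n-1}\hat T^k1_{Y_k}\}_{n\ge1}$ bounded in $L^\infty(\mu)$). Let $q>0$ and $\lambda:(0,\infty)\to(0,\infty)$ with $\lambda(t)\to0$ and $Q^Y(q/t)/(\lambda(t)t)\to0$ as $t\to\infty$. Then $\int_0^\infty e^{-qu}\int_Y \exp(-\lambda(t)S^Y_{[ut]})\,d\mu\,du \sim \frac{Q^Y(q/t)}{\lambda(t)t}$ as $t\to\infty$. -/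
open MeasureTheory Filter Real Set
open scoped Topology ENNReal

section helpers
variable {X : Type*}

lemma lt_firstReturn_iff (T : X → X) (Y : Set X) (x : X) (n : ℕ) :
    (n : ℕ∞) < firstReturn T Y x ↔ ∀ k, 1 ≤ k → k ≤ n → T^[k] x ∉ Y := by
  constructor
  · intro h k h1 hk hY
    have h2 : firstReturn T Y x ≤ (k : ℕ∞) := iInf₂_le (f := fun (k : ℕ) (_ : 1 ≤ k ∧ T^[k] x ∈ Y) => (k : ℕ∞)) k ⟨h1, hY⟩
    have h3 := h.trans_le h2
    have h4 : n < k := by exact_mod_cast h3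
    omega
  · intro h
    have : ((n + 1 : ℕ) : ℕ∞) ≤ firstReturn T Y x := by
      refine le_iInf₂ fun k hk => ?_
      have : n + 1 ≤ k := by
        by_contra hc
        exact h k hk.1 (by omega) hk.2
      exact_mod_cast this
    refine lt_of_lt_of_le ?_ this
    exact_mod_cast Nat.lt_succ_self n

lemma firstReturn_eq_iff (T : X → X) (Y : Set X) (x : X) (n : ℕ) :
    firstReturn T Y x = ((n + 1 : ℕ) : ℕ∞) ↔
      (∀ k, 1 ≤ k → k ≤ n → T^[k] x ∉ Y) ∧ T^[n+1] x ∈ Y := by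
  have h : firstReturn T Y x = ((n + 1 : ℕ) : ℕ∞) ↔
      (n : ℕ∞) < firstReturn T Y x ∧ ¬ ((n + 1 : ℕ) : ℕ∞) < firstReturn T Y x := by
    cases hf : firstReturn T Y x with
    | top =>
      simp only [ENat.top_ne_coe, ENat.coe_lt_top, not_true_eq_false, and_false]
    | coe m => norm_cast; omega
  rw [h, lt_firstReturn_iff, lt_firstReturn_iff]
  constructor
  · rintro ⟨h1, h2⟩
    refine ⟨h1, ?_⟩
    push Not at h2
    obtain ⟨k, hk1, hk2, hk3⟩ := h2
    rcases Nat.lt_or_ge n k with h | h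
    · obtain rfl : k = n + 1 := by omega
      exact hk3
    · exact absurd hk3 (h1 k hk1 h)
  · rintro ⟨h1, h2⟩
    exact ⟨h1, fun h => h (n+1) (by omega) le_rfl h2⟩

lemma tsum_split (f : ℕ → ℝ≥0∞) (k : ℕ) :
    (∑ i ∈ Finset.range k, f i) + ∑' i, f (i + k) = ∑' i, f i :=
  Summable.sum_add_tsum_nat_add' ENNReal.summable

/-- never-returned-by-time-n -/
def Vset (T : X → X) (Y : Set X) (n : ℕ) : Set X := {x | (n : ℕ∞) < firstReturn T Y x}
/-- returns exactly at time n+1 -/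
def Eset (T : X → X) (Y : Set X) (n : ℕ) : Set X :=
  {x | firstReturn T Y x = ((n + 1 : ℕ) : ℕ∞)}

lemma preimage_Ypart (T : X → X) (Y : Set X) (n : ℕ) : T ⁻¹' (Ypart T Y n) = Eset T Y n := by
  ext x
  cases n with
  | zero =>
    simp only [Ypart, Eset, mem_preimage, mem_setOf_eq, firstReturn_eq_iff]
    simp
    intro _ k hk hk2; omega
  | succ n =>
    simp only [Ypart, Eset, mem_preimage, mem_setOf_eq, firstReturn_eq_iff, mem_inter_iff, mem_compl_iff]
    simp only [← Function.iterate_succ_apply]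
    constructor
    · rintro ⟨h1, h2, h3⟩
      refine ⟨fun k hk1 hk2 => ?_, h3⟩
      rcases Nat.lt_or_ge 1 k with h | h
      · obtain ⟨j, rfl⟩ : ∃ j, k = j + 1 := ⟨k - 1, by omega⟩
        exact h2 j (by omega) (by omega)
      · obtain rfl : k = 1 := by omega
        exact h1
    · rintro ⟨h1, h2⟩
      exact ⟨h1 1 le_rfl (by omega), fun k hk1 hk2 => h1 (k+1) (by omega) (by omega), h2⟩

lemma Ypart_iterate (T : X → X) (Y : Set X) (n : ℕ) {x : X} (h : x ∈ Ypart T Y n) :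
    T^[n] x ∈ Y := by
  cases n with
  | zero => exact h
  | succ n => exact ((firstReturn_eq_iff T Y x n).1 h.2).2

lemma occ_eq (T : X → X) (Y : Set X) (n : ℕ) (x : X) :
    occTime T Y n x = ∑ k ∈ Finset.range n, Y.indicator (fun _ => (1:ℕ)) (T^[k+1] x) := by
  rw [occTime, Finset.range_eq_Ico, Finset.sum_Ico_add' (fun k => Y.indicator (fun _ => (1:ℕ)) (T^[k] x)) 0 n 1]
  rfl

lemma occ_add (T : X → X) (Y : Set X) (k m : ℕ) (x : X) :
    occTime T Y (k + m) x = occTime T Y k x + occTime T Y m (T^[k] x) := by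
  rw [occ_eq, occ_eq, occ_eq, Finset.sum_range_add]
  congr 1
  refine Finset.sum_congr rfl fun j _ => ?_
  rw [← Function.iterate_add_apply]
  congr 2; omega

lemma occ_zero (T : X → X) (Y : Set X) (n : ℕ) (x : X)
    (h : ∀ k, 1 ≤ k → k ≤ n → T^[k] x ∉ Y) : occTime T Y n x = 0 := by
  rw [occTime]
  refine Finset.sum_eq_zero fun k hk => ?_
  rw [Finset.mem_Icc] at hk
  simp [h k hk.1 hk.2]

/-- the generating function -/
noncomputable def GG (T : X → X) (Y : Set X) (a e : ℝ≥0∞) (x : X) : ℝ≥0∞ :=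
  ∑' n : ℕ, a ^ n * e ^ occTime T Y n x

lemma GG_decomp (T : X → X) (Y : Set X) (a e : ℝ≥0∞) (x : X) :
    GG T Y a e x = (∑' n : ℕ, a ^ n * (Vset T Y n).indicator 1 x) +
      e * ∑' k : ℕ, a ^ (k+1) * (Eset T Y k).indicator (fun x => GG T Y a e (T^[k+1] x)) x := by
  by_cases hx : ∀ k, x ∉ Eset T Y k
  · have hV : ∀ n, ∀ k, 1 ≤ k → k ≤ n → T^[k] x ∉ Y := by
      intro n
      induction n with
      | zero => intro k h1 h2; omega
      | succ n ih =>
        intro k h1 h2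
        rcases Nat.lt_or_ge n k with h | h
        · obtain rfl : k = n + 1 := by omega
          intro hY
          exact hx n ((firstReturn_eq_iff T Y x n).2 ⟨ih, hY⟩)
        · exact ih k h1 h
    have h2 : ∀ n, x ∈ Vset T Y n := fun n => (lt_firstReturn_iff T Y x n).2 (hV n)
    simp [GG, hx, h2, fun n => occ_zero T Y n x (hV n)]
  · push Not at hx
    obtain ⟨k, hk⟩ := hx
    obtain ⟨h1, h2⟩ := (firstReturn_eq_iff T Y x k).1 hk
    have hV : ∀ n, x ∈ Vset T Y n ↔ n < k + 1 := by
      intro n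
      show (n : ℕ∞) < firstReturn T Y x ↔ _
      rw [show firstReturn T Y x = _ from hk]
      norm_cast
    have hE : ∀ n, n ≠ k → x ∉ Eset T Y n := by
      intro n hn hn'
      have : ((n + 1 : ℕ) : ℕ∞) = ((k+1 : ℕ) : ℕ∞) := hn'.symm.trans hk
      norm_cast at this
      omega
    have hocc : occTime T Y (k+1) x = 1 := by
      rw [occ_add, occ_zero T Y k x h1, occ_eq]
      simp only [Finset.range_one, Finset.sum_singleton, zero_add]
      rw [← Function.iterate_add_apply, add_comm 1 k]
      rw [indicator_of_mem h2]
    have hs1 : ∑' j : ℕ, a ^ (j+1) * (Eset T Y j).indicator (fun x => GG T Y a e (T^[j+1] x)) x =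
        a ^ (k+1) * (Eset T Y k).indicator (fun x => GG T Y a e (T^[k+1] x)) x :=
      tsum_eq_single k (fun n hn => by rw [indicator_of_notMem (hE n hn), mul_zero])
    have hs2 : ∑' n : ℕ, a ^ n * (Vset T Y n).indicator 1 x =
        ∑ n ∈ Finset.range (k+1), a ^ n * (Vset T Y n).indicator 1 x :=
      tsum_eq_sum (fun n hn => by
        rw [Finset.mem_range] at hn
        rw [indicator_of_notMem (fun h => hn ((hV n).1 h)), mul_zero])
    rw [hs1, hs2, indicator_of_mem hk]
    rw [GG, ← tsum_split (fun n => a ^ n * e ^ occTime T Y n x) (k+1)]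
    congr 1
    · refine Finset.sum_congr rfl fun n hn => ?_
      rw [Finset.mem_range] at hn
      rw [indicator_of_mem ((hV n).2 hn), occ_zero T Y n x (fun j hj hj' => h1 j hj (by omega))]
      simp
    · rw [GG, ← ENNReal.tsum_mul_left, ← ENNReal.tsum_mul_left]
      refine tsum_congr fun m => ?_
      rw [add_comm m, occ_add, hocc, pow_add, pow_add e, pow_one]
      ring

variable [MeasurableSpace X] {μ : Measure X} {T : X → X} {Y : Set X}

lemma meas_V (hT : Measurable T) (hY : MeasurableSet Y) (n : ℕ) : MeasurableSet (Vset T Y n) := by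
  have : Vset T Y n = ⋂ k, ⋂ (_ : 1 ≤ k ∧ k ≤ n), (T^[k]) ⁻¹' Yᶜ := by
    ext x
    simp [Vset, lt_firstReturn_iff]
  rw [this]
  exact MeasurableSet.iInter fun k => MeasurableSet.iInter fun _ => (hT.iterate k) hY.compl

lemma meas_E (hT : Measurable T) (hY : MeasurableSet Y) (n : ℕ) : MeasurableSet (Eset T Y n) := by
  have : Eset T Y n = Vset T Y n ∩ (T^[n+1]) ⁻¹' Y := by
    ext x
    simp only [Eset, Vset, mem_setOf_eq, firstReturn_eq_iff, mem_inter_iff, lt_firstReturn_iff, mem_preimage]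
  rw [this]
  exact (meas_V hT hY n).inter ((hT.iterate _) hY)

lemma meas_Ypart (hT : Measurable T) (hY : MeasurableSet Y) (n : ℕ) :
    MeasurableSet (Ypart T Y n) := by
  cases n with
  | zero => exact hY
  | succ n => exact hY.compl.inter (meas_E hT hY n)

lemma meas_occ (hT : Measurable T) (hY : MeasurableSet Y) (n : ℕ) :
    Measurable (occTime T Y n) := by
  unfold occTime
  exact Finset.measurable_sum _ fun k _ => (measurable_const.indicator hY).comp (hT.iterate k)

lemma meas_G (hT : Measurable T) (hY : MeasurableSet Y) (a e : ℝ≥0∞) :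
    Measurable (GG T Y a e) := by
  unfold GG
  refine Measurable.ennreal_tsum fun n => Measurable.const_mul ?_ _
  exact (measurable_from_nat (f := fun k => e ^ k)).comp (meas_occ hT hY n)

/-- B_n -/
noncomputable def BB (T : X → X) (Y : Set X) (μ : Measure X) (G : X → ℝ≥0∞) (n : ℕ) : ℝ≥0∞ :=
  ∫⁻ x in Ypart T Y n, G (T^[n] x) ∂μ

lemma BB_succ (hT : MeasurePreserving T μ μ) (hY : MeasurableSet Y) {G : X → ℝ≥0∞}
    (hG : Measurable G) (n : ℕ) :
    BB T Y μ G n = (∫⁻ x in Y ∩ Eset T Y n, G (T^[n+1] x) ∂μ) + BB T Y μ G (n+1) := by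
  have h1 : BB T Y μ G n = ∫⁻ x in Eset T Y n, G (T^[n+1] x) ∂μ := by
    rw [BB, ← preimage_Ypart]
    exact (hT.setLIntegral_comp_preimage (meas_Ypart hT.measurable hY n)
      (hG.comp (hT.measurable.iterate n))).symm
  rw [h1, ← lintegral_inter_add_diff _ (Eset T Y n) hY, inter_comm, BB, diff_eq, inter_comm _ Yᶜ]
  rfl

lemma BB_le (hT : MeasurePreserving T μ μ) (hY : MeasurableSet Y) {G : X → ℝ≥0∞}
    (hG : Measurable G) (n : ℕ) : BB T Y μ G n ≤ ∫⁻ x in Y, G x ∂μ := by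
  induction n with
  | zero => exact le_rfl
  | succ n ih => 
    rw [BB_succ hT hY hG] at ih
    exact le_add_self.trans ih

lemma identity (hT : MeasurePreserving T μ μ) (hY : MeasurableSet Y) (a e : ℝ≥0∞) :
    (∫⁻ x in Y, GG T Y a e x ∂μ) + e * (∑' n : ℕ, a ^ n * BB T Y μ (GG T Y a e) n) =
    (∑' n : ℕ, a ^ n * μ (Y ∩ Vset T Y n)) + e * (a * (∑' n : ℕ, a ^ n * BB T Y μ (GG T Y a e) n)
      + ∫⁻ x in Y, GG T Y a e x ∂μ) := by
  have hG := meas_G hT.measurable hY a e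
  set G := GG T Y a e with hGdef
  set P := ∑' k : ℕ, a ^ (k+1) * ∫⁻ x in Y ∩ Eset T Y k, G (T^[k+1] x) ∂μ with hP
  have h1 : ∫⁻ x in Y, G x ∂μ = (∑' n : ℕ, a ^ n * μ (Y ∩ Vset T Y n)) + e * P := by
    have hmV : ∀ n, Measurable fun x => a ^ n * (Vset T Y n).indicator (1 : X → ℝ≥0∞) x := fun n =>
      (measurable_one.indicator (meas_V hT.measurable hY n)).const_mul _
    have hmE : ∀ k, Measurable fun x => a ^ (k+1) * (Eset T Y k).indicator (fun x => G (T^[k+1] x)) x :=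
      fun k => ((hG.comp (hT.measurable.iterate (k+1))).indicator (meas_E hT.measurable hY k)).const_mul _
    rw [lintegral_congr (fun x => GG_decomp T Y a e x),
      lintegral_add_left (Measurable.ennreal_tsum hmV),
      lintegral_tsum (fun n => (hmV n).aemeasurable),
      lintegral_const_mul _ (Measurable.ennreal_tsum hmE),
      lintegral_tsum (fun n => (hmE n).aemeasurable)]
    congr 1
    · refine tsum_congr fun n => ?_
      rw [lintegral_const_mul _ (measurable_one.indicator (meas_V hT.measurable hY n)),
        lintegral_indicator_one (meas_V hT.measurable hY n),
        Measure.restrict_apply (meas_V hT.measurable hY n), inter_comm]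
    · congr 1
      refine tsum_congr fun n => ?_
      have hmn : Measurable ((Eset T Y n).indicator (fun x => G (T^[n+1] x))) :=
        (hG.comp (hT.measurable.iterate (n+1))).indicator (meas_E hT.measurable hY n)
      rw [lintegral_const_mul _ hmn,
        lintegral_indicator (meas_E hT.measurable hY n),
        Measure.restrict_restrict (meas_E hT.measurable hY n), inter_comm]
  have h2 : P + (∑' n : ℕ, a ^ n * BB T Y μ G n) =
      a * (∑' n : ℕ, a ^ n * BB T Y μ G n) + ∫⁻ x in Y, G x ∂μ := by
    conv_lhs => rw [tsum_eq_zero_add' (f := fun n => a ^ n * BB T Y μ G n) ENNReal.summable]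
    rw [← ENNReal.tsum_mul_left, add_left_comm, hP, ← ENNReal.tsum_add, add_comm]
    congr 1
    · refine tsum_congr fun n => ?_
      rw [BB_succ hT hY hG n]
      ring
    · simp [BB, Ypart]
  rw [← h2, mul_add, ← add_assoc, ← h1]

lemma hatT_iter (hT : Measurable T) {hatT : (X → ℝ≥0∞) → (X → ℝ≥0∞)}
    (hatTmeas : ∀ u, Measurable u → Measurable (hatT u))
    (hatTdual : ∀ u v : X → ℝ≥0∞, Measurable u → Measurable v →
      ∫⁻ x, v (T x) * u x ∂μ = ∫⁻ x, v x * hatT u x ∂μ) (n : ℕ) :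
    ∀ u v : X → ℝ≥0∞, Measurable u → Measurable v → Measurable (hatT^[n] u) ∧
      ∫⁻ x, v (T^[n] x) * u x ∂μ = ∫⁻ x, v x * hatT^[n] u x ∂μ := by
  induction n with
  | zero => intro u v hu hv; exact ⟨hu, rfl⟩
  | succ n ih =>
    intro u v hu hv
    refine ⟨(ih (hatT u) v (hatTmeas u hu) hv).1, ?_⟩
    rw [Function.iterate_succ_apply, ← (ih (hatT u) v (hatTmeas u hu) hv).2]
    exact hatTdual u _ hu (hv.comp (hT.iterate n))

lemma abel (a : ℝ≥0∞) (ha : a < 1) (h : ℕ → ℝ≥0∞) :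
    ∑' n, a ^ n * h n = (1 - a) * ∑' m, a ^ m * ∑ n ∈ Finset.range (m+1), h n := by
  have h0 : (1 - a) * (1 - a)⁻¹ = 1 := ENNReal.mul_inv_cancel (tsub_pos_of_lt ha).ne'
    (ne_top_of_le_ne_top ENNReal.one_ne_top tsub_le_self)
  have h1 : ∀ m, a ^ m * ∑ n ∈ Finset.range (m+1), h n =
      ∑' n, (if n ≤ m then a ^ m * h n else 0) := by
    intro m
    rw [tsum_eq_sum (s := Finset.range (m+1)) (fun n hn => by
      rw [Finset.mem_range] at hn
      rw [if_neg (by omega)]), Finset.mul_sum]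
    refine Finset.sum_congr rfl fun n hn => ?_
    rw [Finset.mem_range] at hn
    rw [if_pos (by omega)]
  simp_rw [h1]
  rw [ENNReal.tsum_comm, ← ENNReal.tsum_mul_left]
  refine tsum_congr fun n => ?_
  rw [← tsum_split (fun m => if n ≤ m then a ^ m * h n else 0) n, Finset.sum_eq_zero (fun m hm => by
    rw [Finset.mem_range] at hm
    rw [if_neg (by omega)]), zero_add]
  have : ∀ m, (if n ≤ m + n then a ^ (m+n) * h n else 0) = a ^ m * (a ^ n * h n) := by
    intro m
    rw [if_pos (by omega)]; ring
  simp_rw [this]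
  rw [ENNReal.tsum_mul_right, ENNReal.tsum_geometric, ← mul_assoc, h0, one_mul]

lemma K_le (hT : Measurable T) (hY : MeasurableSet Y) {hatT : (X → ℝ≥0∞) → (X → ℝ≥0∞)}
    (hatTmeas : ∀ u, Measurable u → Measurable (hatT u))
    (hatTdual : ∀ u v : X → ℝ≥0∞, Measurable u → Measurable v →
      ∫⁻ x, v (T x) * u x ∂μ = ∫⁻ x, v x * hatT u x ∂μ)
    {C : ℝ≥0∞} (hC : ∀ n : ℕ, 1 ≤ n → ∀ᵐ x ∂μ,
      ∑ k ∈ Finset.range n, (hatT^[k] ((Ypart T Y k).indicator fun _ => (1:ℝ≥0∞))) x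
        ≤ C * wrate T Y μ n) {G : X → ℝ≥0∞} (hG : Measurable G) (a : ℝ≥0∞) (ha : a < 1) :
    (∑' n : ℕ, a ^ n * BB T Y μ G n) ≤
      C * (∑' n : ℕ, a ^ n * μ (Y ∩ Vset T Y n)) * ∫⁻ x in Y, G x ∂μ := by
  set h : ℕ → X → ℝ≥0∞ := fun k => hatT^[k] ((Ypart T Y k).indicator fun _ => (1:ℝ≥0∞)) with hh
  have hm1 : ∀ n, Measurable ((Ypart T Y n).indicator fun _ => (1:ℝ≥0∞)) := fun n =>
    measurable_const.indicator (meas_Ypart hT hY n)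
  have hGY : Measurable (Y.indicator G) := hG.indicator hY
  have hm : ∀ n, Measurable (h n) := fun n =>
    (hatT_iter hT hatTmeas hatTdual n _ (Y.indicator G) (hm1 n) hGY).1
  have hB : ∀ n, BB T Y μ G n = ∫⁻ x in Y, G x * h n x ∂μ := by
    intro n
    have h1 := (hatT_iter hT hatTmeas hatTdual n _ (Y.indicator G) (hm1 n) hGY).2
    rw [BB, ← lintegral_indicator (meas_Ypart hT hY n), ← lintegral_indicator hY]
    convert h1 using 2
    · ext x
      by_cases hx : x ∈ Ypart T Y n
      · simp [hx, Ypart_iterate T Y n hx]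
      · simp [hx]
    · ext x
      by_cases hx : x ∈ Y <;> simp [hx, h]
  have hae : ∀ᵐ x ∂μ, ∀ m : ℕ, ∑ k ∈ Finset.range (m+1), h k x ≤ C * wrate T Y μ (m+1) :=
    ae_all_iff.2 fun m => hC (m+1) (by omega)
  have hae2 : ∀ᵐ x ∂μ, ∑' n, a ^ n * h n x ≤ C * (∑' n : ℕ, a ^ n * μ (Y ∩ Vset T Y n)) := by
    filter_upwards [hae] with x hx
    rw [abel a ha (fun n => h n x), abel a ha (fun n => μ (Y ∩ Vset T Y n)), mul_left_comm, ← ENNReal.tsum_mul_left (a := C)]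
    refine mul_le_mul_right (ENNReal.tsum_le_tsum fun m => ?_) _
    rw [mul_left_comm]
    exact mul_le_mul_right (hx m) _
  calc (∑' n : ℕ, a ^ n * BB T Y μ G n) = ∫⁻ x in Y, (∑' n, a ^ n * h n x) * G x ∂μ := by
        simp_rw [hB, ← ENNReal.tsum_mul_right]
        have hmm : ∀ n, Measurable fun x => a ^ n * h n x * G x := fun n =>
          ((hm n).const_mul _).mul hG
        rw [lintegral_tsum (fun n => (hmm n).aemeasurable)]
        refine tsum_congr fun n => ?_
        have hmn : Measurable fun x => G x * h n x := hG.mul (hm n)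
        rw [← lintegral_const_mul _ hmn]
        refine lintegral_congr fun x => ?_
        ring
    _ ≤ ∫⁻ x in Y, (C * (∑' n : ℕ, a ^ n * μ (Y ∩ Vset T Y n))) * G x ∂μ := by
        refine lintegral_mono_ae ?_
        filter_upwards [ae_restrict_of_ae hae2] with x hx
        gcongr
    _ = _ := lintegral_const_mul _ hG

end helpers

lemma discretize (q t : ℝ) (hq : 0 < q) (ht : 0 < t) (f : ℕ → ℝ≥0∞) :
    ∫⁻ u in Set.Ioi (0:ℝ), ENNReal.ofReal (Real.exp (-q * u)) * f ⌊u * t⌋₊ =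
      ENNReal.ofReal ((1 - Real.exp (-(q / t))) / q) *
        ∑' n : ℕ, ENNReal.ofReal (Real.exp (-(q / t))) ^ n * f n := by
  have hU : Set.Ici (0:ℝ) = ⋃ n : ℕ, Set.Ico ((n:ℝ) / t) (((n:ℝ) + 1) / t) := by
    ext u
    simp only [mem_Ici, mem_iUnion, mem_Ico]
    constructor
    · intro hu
      refine ⟨⌊u * t⌋₊, ?_, ?_⟩
      · rw [div_le_iff₀ ht]; exact Nat.floor_le (by positivity)
      · rw [lt_div_iff₀ ht]; exact Nat.lt_floor_add_one _
    · rintro ⟨n, h1, _⟩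
      exact le_trans (by positivity) h1
  have hfl : ∀ (n : ℕ) (u : ℝ), u ∈ Set.Ico ((n:ℝ) / t) (((n:ℝ) + 1) / t) → ⌊u * t⌋₊ = n := by
    intro n u hu
    have h0 : 0 ≤ u := le_trans (by positivity) hu.1
    rw [Nat.floor_eq_iff (by positivity)]
    exact ⟨(div_le_iff₀ ht).1 hu.1, (lt_div_iff₀ ht).1 hu.2⟩
  rw [setLIntegral_congr Ioi_ae_eq_Ici, hU, lintegral_iUnion (fun n => measurableSet_Ico),
    ← ENNReal.tsum_mul_left]
  · refine tsum_congr fun n => ?_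
    rw [setLIntegral_congr_fun (g := fun u => ENNReal.ofReal (Real.exp (-q * u)) * f n) measurableSet_Ico
      (fun u hu => by simp only [hfl n u hu]), lintegral_mul_const _ (by fun_prop), ← mul_assoc]
    congr 1
    rw [setLIntegral_congr Ico_ae_eq_Ioc, ← ofReal_integral_eq_lintegral_ofReal
      ((Continuous.integrableOn_Icc (by fun_prop)).mono_set Ioc_subset_Icc_self)
      (ae_of_all _ fun u => (Real.exp_pos _).le),
      ← intervalIntegral.integral_of_le (by gcongr; linarith),
      ← ENNReal.ofReal_pow (Real.exp_pos _).le, ← ENNReal.ofReal_mul (by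
        apply div_nonneg _ hq.le
        have : Real.exp (-(q/t)) ≤ 1 := Real.exp_le_one_iff.2 (by
          have : 0 < q / t := by positivity
          linarith)
        linarith)]
    congr 1
    rw [intervalIntegral.integral_comp_mul_left (fun x => Real.exp x) (by linarith : -q ≠ 0), integral_exp,
      ← Real.exp_nat_mul]
    have h2 : -q * (((n:ℝ)+1) / t) = n * -(q/t) + -(q/t) := by field_simp; ring
    have h3 : -q * ((n:ℝ) / t) = n * -(q/t) := by field_simp
    rw [h2, h3, Real.exp_add, smul_eq_mul]
    field_simp
    ring
  · intro m n hmn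
    rw [Function.onFun, Set.disjoint_left]
    intro u hu hu'
    exact hmn ((hfl m u hu).symm.trans (hfl n u hu'))

lemma exp_neg_lt1 {x : ℝ} (h : x < 0) : Real.exp x < 1 := by
  rw [← Real.exp_zero]
  exact Real.exp_lt_exp.2 h

lemma tendsto_one_sub_exp : Tendsto (fun s : ℝ => (1 - Real.exp (-s)) / s) (𝓝[≠] 0) (𝓝 1) := by
  have h : HasDerivAt (fun s : ℝ => - Real.exp (-s)) 1 0 := by
    have := ((hasDerivAt_neg (0:ℝ)).exp).fun_neg
    have e1 : (1:ℝ) = -(Real.exp (-0) * -1) := by simp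
    rw [e1]
    exact this
  have := h.tendsto_slope_zero
  refine this.congr fun s => ?_
  simp
  ring

lemma real_bounds {j Q k C e a l t q : ℝ} (hQ : 0 < Q) (hj : 0 ≤ j) (hk0 : 0 ≤ k) (hC : 0 ≤ C)
    (he : e < 1) (he0 : 0 ≤ e) (ha : a < 1) (hl : 0 < l) (ht : 0 < t) (hq : 0 < q)
    (h1 : j + e * k = Q + e * (a * k + j)) (h2 : k ≤ C * Q * j) :
    ((1 - a) / (q / t)) / ((1 - e) / l + ((1 - a) / (q / t)) * q * C * (Q / (l * t))) ≤
      (1 - a) / q * j / (Q / (l * t)) ∧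
    (1 - a) / q * j / (Q / (l * t)) ≤ ((1 - a) / (q / t)) / ((1 - e) / l) := by
  have h1a : 0 < 1 - a := by linarith
  have h1e : 0 < 1 - e := by linarith
  have e1 : (1 - a) / q * j / (Q / (l * t)) = ((1 - a) / (q / t)) * (l * j / Q) := by
    field_simp
  have hx : 0 < (1 - a) / (q / t) := by positivity
  rw [e1, div_eq_mul_inv _ ((1 - e) / l + _), div_eq_mul_inv _ ((1 - e) / l)]
  have hjk : 0 ≤ e * (1 - a) * k := by positivity
  constructor
  · refine mul_le_mul_of_nonneg_left ?_ hx.le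
    rw [inv_le_iff_one_le_mul₀ (by positivity)]
    have e2 : l * j / Q * ((1 - e) / l + (1 - a) / (q / t) * q * C * (Q / (l * t))) =
        ((1 - e) * j + (1 - a) * (C * Q * j)) / Q := by
      field_simp
    rw [e2, le_div_iff₀ hQ]
    have : e * ((1 - a) * k) ≤ 1 * ((1 - a) * (C * Q * j)) := by gcongr
    linarith
  · refine mul_le_mul_of_nonneg_left ?_ hx.le
    rw [inv_div, div_le_div_iff₀ hQ h1e, mul_assoc]
    gcongr
    linarith

/-- Double Laplace asymptotics for the occupation time of `Y`:
`∫₀^∞ e^{-qu} ∫_Y exp(-λ(t) S_{[ut]}^Y) dμ du ~ Q^Y(q/t)/(λ(t)t)` as `t → ∞`. -/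
theorem stmt19 {X : Type*} [MeasurableSpace X] {μ : Measure X} [SigmaFinite μ]
    {T : X → X} (hcons : Conservative T μ) (herg : Ergodic T μ)
    (hinf : μ Set.univ = ⊤) {Y : Set X} (hYm : MeasurableSet Y)
    (hY0 : 0 < μ Y) (hY1 : μ Y < ⊤)
    (hatT : (X → ℝ≥0∞) → (X → ℝ≥0∞))
    (hatTmeas : ∀ u, Measurable u → Measurable (hatT u))
    (hatTdual : ∀ u v : X → ℝ≥0∞, Measurable u → Measurable v →
      ∫⁻ x, v (T x) * u x ∂μ = ∫⁻ x, v x * hatT u x ∂μ)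
    -- (B3): `L^∞`-boundedness of the normalized entrance densities
    (hB3 : ∃ C : ℝ≥0∞, C ≠ ⊤ ∧ ∀ n : ℕ, 1 ≤ n → ∀ᵐ x ∂μ,
      ∑ k ∈ Finset.range n, (hatT^[k] ((Ypart T Y k).indicator fun _ => (1:ℝ≥0∞))) x
        ≤ C * wrate T Y μ n)
    (q : ℝ) (hq : 0 < q)
    (lam : ℝ → ℝ) (hlampos : ∀ t, 0 < lam t) (hlam : Tendsto lam atTop (𝓝 0))
    (hQlam : Tendsto (fun t : ℝ => QY T Y μ (q / t) / ENNReal.ofReal (lam t * t))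
      atTop (𝓝 0)) :
    Tendsto (fun t : ℝ =>
      (∫⁻ u in Set.Ioi (0:ℝ), ENNReal.ofReal (Real.exp (-q * u)) *
        ∫⁻ x in Y, ENNReal.ofReal (Real.exp (-(lam t) * occTime T Y ⌊u * t⌋₊ x)) ∂μ) /
      (QY T Y μ (q / t) / ENNReal.ofReal (lam t * t)))
      atTop (𝓝 1) := by

  have hT : MeasurePreserving T μ μ := herg.toMeasurePreserving
  obtain ⟨C, hCtop, hC⟩ := hB3
  set a : ℝ → ℝ := fun t => Real.exp (-(q / t)) with ha_def
  set e : ℝ → ℝ := fun t => Real.exp (-(lam t)) with he_def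
  set J : ℝ → ℝ≥0∞ := fun t =>
    ∫⁻ x in Y, GG T Y (ENNReal.ofReal (a t)) (ENNReal.ofReal (e t)) x ∂μ with hJ_def
  set K : ℝ → ℝ≥0∞ := fun t => ∑' n : ℕ, ENNReal.ofReal (a t) ^ n *
    BB T Y μ (GG T Y (ENNReal.ofReal (a t)) (ENNReal.ofReal (e t))) n with hK_def
  set Q : ℝ → ℝ≥0∞ := fun t => QY T Y μ (q / t) with hQ_def
  have he1 : ∀ t, e t < 1 := fun t => exp_neg_lt1 (by linarith [hlampos t])
  have he0 : ∀ t, 0 < e t := fun t => Real.exp_pos _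
  have ha0 : ∀ t, 0 < a t := fun t => Real.exp_pos _
  have ha1 : ∀ t, 0 < t → a t < 1 := fun t ht => exp_neg_lt1 (by
    have : 0 < q / t := by positivity
    linarith)
  have haE : ∀ t, 0 < t → ENNReal.ofReal (a t) < 1 := fun t ht => by
    rw [ENNReal.ofReal_lt_one]; exact ha1 t ht
  have heE : ∀ t, ENNReal.ofReal (e t) ≤ 1 := fun t => by
    rw [ENNReal.ofReal_le_one]; exact (he1 t).le
  have hgeo : ∀ t, 0 < t → (∑' n : ℕ, ENNReal.ofReal (a t) ^ n) ≠ ⊤ := fun t ht => by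
    rw [ENNReal.tsum_geometric]
    exact ENNReal.inv_ne_top.2 (tsub_pos_of_lt (haE t ht)).ne'
  have hQeq : ∀ t, Q t = ∑' n : ℕ, ENNReal.ofReal (a t) ^ n * μ (Y ∩ Vset T Y n) := by
    intro t
    refine tsum_congr fun n => ?_
    rw [← ENNReal.ofReal_pow (ha0 t).le, ← Real.exp_nat_mul]
    congr 3
    ring
  have hQtop : ∀ t, 0 < t → Q t ≠ ⊤ := by
    intro t ht
    have : Q t ≤ (∑' n : ℕ, ENNReal.ofReal (a t) ^ n) * μ Y := by
      rw [hQeq, ← ENNReal.tsum_mul_right]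
      gcongr
      exact inter_subset_left
    exact ne_top_of_le_ne_top (ENNReal.mul_ne_top (hgeo t ht) hY1.ne) this
  have hQpos : ∀ t, Q t ≠ 0 := by
    intro t
    have h1 : μ Y ≤ Q t := by
      rw [hQeq]
      refine le_trans ?_ (ENNReal.le_tsum 0)
      rw [pow_zero, one_mul]
      refine measure_mono fun x hx => ⟨hx, ?_⟩
      exact (lt_firstReturn_iff T Y x 0).2 (fun k h1 h2 => by omega)
    exact (hY0.trans_le h1).ne'
  have hJtop : ∀ t, 0 < t → J t ≠ ⊤ := by
    intro t ht
    have : J t ≤ ∫⁻ x in Y, (∑' n : ℕ, ENNReal.ofReal (a t) ^ n) ∂μ := by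
      refine lintegral_mono fun x => ?_
      unfold GG
      refine ENNReal.tsum_le_tsum fun n => ?_
      exact mul_le_of_le_one_right' (pow_le_one₀ zero_le (heE t))
    refine ne_top_of_le_ne_top ?_ this
    rw [setLIntegral_const]
    exact ENNReal.mul_ne_top (hgeo t ht) hY1.ne
  have hKle : ∀ t, 0 < t → K t ≤ C * Q t * J t := by
    intro t ht
    rw [hQeq]
    exact K_le hT.measurable hYm hatTmeas hatTdual hC (meas_G hT.measurable hYm _ _) _ (haE t ht)
  have hKtop : ∀ t, 0 < t → K t ≠ ⊤ := fun t ht => ne_top_of_le_ne_top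
    (ENNReal.mul_ne_top (ENNReal.mul_ne_top hCtop (hQtop t ht)) (hJtop t ht)) (hKle t ht)
  have hid : ∀ t, J t + ENNReal.ofReal (e t) * K t =
      Q t + ENNReal.ofReal (e t) * (ENNReal.ofReal (a t) * K t + J t) := by
    intro t
    rw [hQeq]
    exact identity hT hYm _ _
  have hidR : ∀ t, 0 < t → (J t).toReal + e t * (K t).toReal =
      (Q t).toReal + e t * (a t * (K t).toReal + (J t).toReal) := by
    intro t ht
    have h1 := hJtop t ht
    have h2 := hKtop t ht
    have h3 := hQtop t ht
    have := congrArg ENNReal.toReal (hid t)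
    rw [ENNReal.toReal_add h1 (ENNReal.mul_ne_top ENNReal.ofReal_ne_top h2),
      ENNReal.toReal_add h3 (ENNReal.mul_ne_top ENNReal.ofReal_ne_top (ENNReal.add_ne_top.2
        ⟨ENNReal.mul_ne_top ENNReal.ofReal_ne_top h2, h1⟩)), ENNReal.toReal_mul, ENNReal.toReal_mul,
      ENNReal.toReal_add (ENNReal.mul_ne_top ENNReal.ofReal_ne_top h2) h1, ENNReal.toReal_mul,
      ENNReal.toReal_ofReal (he0 t).le, ENNReal.toReal_ofReal (ha0 t).le] at this
    exact this
  have hKleR : ∀ t, 0 < t → (K t).toReal ≤ C.toReal * (Q t).toReal * (J t).toReal := by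
    intro t ht
    rw [← ENNReal.toReal_mul, ← ENNReal.toReal_mul]
    exact ENNReal.toReal_mono
      (ENNReal.mul_ne_top (ENNReal.mul_ne_top hCtop (hQtop t ht)) (hJtop t ht)) (hKle t ht)
  have hQR : ∀ t, 0 < t → 0 < (Q t).toReal := fun t ht =>
    ENNReal.toReal_pos (hQpos t) (hQtop t ht)
  have hbd := fun t (ht : 0 < t) => real_bounds (hQR t ht) ENNReal.toReal_nonneg
    ENNReal.toReal_nonneg ENNReal.toReal_nonneg (he1 t) (he0 t).le (ha1 t ht) (hlampos t) ht hq
    (hidR t ht) (hKleR t ht)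
  -- limits
  have hx : Tendsto (fun t : ℝ => (1 - a t) / (q / t)) atTop (𝓝 1) := by
    refine tendsto_one_sub_exp.comp (tendsto_nhdsWithin_iff.2
      ⟨tendsto_const_nhds.div_atTop tendsto_id, ?_⟩)
    filter_upwards [eventually_gt_atTop 0] with t ht
    exact (div_pos hq ht).ne'
  have hy : Tendsto (fun t : ℝ => (1 - e t) / lam t) atTop (𝓝 1) :=
    tendsto_one_sub_exp.comp (tendsto_nhdsWithin_iff.2
      ⟨hlam, Eventually.of_forall fun t => (hlampos t).ne'⟩)
  have hz : Tendsto (fun t : ℝ => (Q t).toReal / (lam t * t)) atTop (𝓝 0) := by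
    have := (ENNReal.tendsto_toReal ENNReal.zero_ne_top).comp hQlam
    refine Tendsto.congr' ?_ this
    filter_upwards [eventually_gt_atTop 0] with t ht
    have := mul_pos (hlampos t) ht
    simp only [Function.comp, ENNReal.toReal_div, ENNReal.toReal_ofReal this.le, Q]
  have hlow := hx.div (hy.add (((hx.mul_const q).mul_const C.toReal).mul hz)) (by norm_num)
  have hup := hx.div hy (by norm_num)
  have hmain : Tendsto (fun t : ℝ => (1 - a t) / q * (J t).toReal / ((Q t).toReal / (lam t * t)))
      atTop (𝓝 1) := by
    refine tendsto_of_tendsto_of_tendsto_of_le_of_le' (by simpa using hlow) (by simpa using hup) ?_ ?_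
    · filter_upwards [eventually_gt_atTop 0] with t ht
      exact (hbd t ht).1
    · filter_upwards [eventually_gt_atTop 0] with t ht
      exact (hbd t ht).2
  have hfin := ENNReal.tendsto_ofReal hmain
  rw [ENNReal.ofReal_one] at hfin
  refine hfin.congr' ?_
  filter_upwards [eventually_gt_atTop 0] with t ht
  have hlt := mul_pos (hlampos t) ht
  have h1 : (∫⁻ u in Set.Ioi (0:ℝ), ENNReal.ofReal (Real.exp (-q * u)) *
        ∫⁻ x in Y, ENNReal.ofReal (Real.exp (-(lam t) * occTime T Y ⌊u * t⌋₊ x)) ∂μ) =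
      ENNReal.ofReal ((1 - a t) / q) * J t := by
    rw [discretize q t hq ht (fun n =>
      ∫⁻ x in Y, ENNReal.ofReal (Real.exp (-(lam t) * occTime T Y n x)) ∂μ)]
    congr 1
    have hpow : ∀ n x, ENNReal.ofReal (Real.exp (-(lam t) * occTime T Y n x)) =
        ENNReal.ofReal (e t) ^ occTime T Y n x := by
      intro n x
      rw [← ENNReal.ofReal_pow (he0 t).le, ← Real.exp_nat_mul]
      congr 2
      ring
    have hm : ∀ n, Measurable fun x => ENNReal.ofReal (e t) ^ occTime T Y n x := fun n =>
      (measurable_from_nat (f := fun k => ENNReal.ofReal (e t) ^ k)).comp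
        (meas_occ hT.measurable hYm n)
    simp only [hpow, J, GG]
    rw [lintegral_tsum (fun n => ((hm n).const_mul _).aemeasurable)]
    refine tsum_congr fun n => ?_
    rw [lintegral_const_mul _ (hm n)]
  rw [h1, ENNReal.ofReal_div_of_pos (div_pos (hQR t ht) hlt), ENNReal.ofReal_div_of_pos hlt,
    ENNReal.ofReal_mul (div_nonneg (by linarith [ha1 t ht]) hq.le),
    ENNReal.ofReal_toReal (hJtop t ht), ENNReal.ofReal_toReal (hQtop t ht)]
end
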